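/- arXiv:1808.00582 — 3 statements merged into one kernel-verified Lean document; each statement's English description precedes it below -/
import Mathlib

section
/- Let n ≥ 1 and let μ be a partition of n. Then Σ_{s=0}^{n} (−t)^s e_{n−s}[B_μ] equals ∏_{i=0}^{n−1} (q^i − t) if μ = (n), and equals 0 for every other partition μ of n. -/
open scoped Classical
open MvPolynomial Finset

noncomputable section

/-! ## The base field `ℚ(q,t)` -/

/-- The polynomial ring `ℚ[q,t]`. -/
abbrev Rqt : Type := MvPolynomial (Fin 2) ℚ

/-- The field `ℚ(q,t)` of rational functions in `q` and `t`. -/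
abbrev Kqt : Type := FractionRing Rqt

/-- The variable `q` of `ℚ(q,t)`. -/
def qK : Kqt := algebraMap Rqt Kqt (X 0)

/-- The variable `t` of `ℚ(q,t)`. -/
def tK : Kqt := algebraMap Rqt Kqt (X 1)

/-- The `x`-analogue `[n]ₓ = 1 + x + ⋯ + x^(n-1)` of `n`. -/
def qaK (x : Kqt) (n : ℕ) : Kqt := ∑ i ∈ range n, x ^ i

/-- `[n]ₓ` for an integer `n`, zero for negative `n`. -/
def qaZ (x : Kqt) (z : ℤ) : Kqt := if 0 ≤ z then qaK x z.toNat else 0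

/-- The `x`-factorial `[n]ₓ!`. -/
def qfacK (x : Kqt) (n : ℕ) : Kqt := ∏ i ∈ range n, qaK x (i + 1)

/-- The Gaussian binomial coefficient `qbinom(a,b)ₓ`, zero unless `0 ≤ b ≤ a`. -/
def qbinK (x : Kqt) (a b : ℤ) : Kqt :=
  if 0 ≤ b ∧ b ≤ a then qfacK x a.toNat / (qfacK x b.toNat * qfacK x (a - b).toNat) else 0

/-! ## Partitions, cells, and the standard `q,t`-quantities `B_μ`, `T_μ`, `Π_μ` -/

/-- The parts of a partition, sorted in weakly decreasing order. -/
def partsListP {n : ℕ} (μ : n.Partition) : List ℕ := (μ.parts.sort (· ≤ ·)).reverse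

/-- The `r`-th part (0-indexed) of a partition, `0` beyond the last part. -/
def partOfP {n : ℕ} (μ : n.Partition) (r : ℕ) : ℕ := (partsListP μ).getD r 0

/-- The number of parts `ℓ(μ)`. -/
def numPartsP {n : ℕ} (μ : n.Partition) : ℕ := Multiset.card μ.parts

/-- The `r`-th part (0-indexed) of the conjugate partition `μ'`. -/
def conjPartP {n : ℕ} (μ : n.Partition) (r : ℕ) : ℕ :=
  Multiset.card (μ.parts.filter (fun x => r < x))

/-- The cells `(a'(c), l'(c))` (co-arm, co-leg) of the Ferrers diagram of `μ`. -/
def cellsP {n : ℕ} (μ : n.Partition) : List (ℕ × ℕ) :=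
  (List.range (numPartsP μ)).flatMap
    (fun r => (List.range (partOfP μ r)).map (fun c => (c, r)))

/-- The monomial `q^(a'(c)) t^(l'(c))` attached to a cell. -/
def monQT (c : ℕ × ℕ) : Kqt := qK ^ c.1 * tK ^ c.2

/-- `B_μ = Σ_{c ∈ μ} q^(a'(c)) t^(l'(c))`. -/
def BmuP {n : ℕ} (μ : n.Partition) : Kqt := ((cellsP μ).map monQT).sum

/-- `T_μ = Π_{c ∈ μ} q^(a'(c)) t^(l'(c))`. -/
def TmuP {n : ℕ} (μ : n.Partition) : Kqt := ((cellsP μ).map monQT).prod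

/-- `Π_μ = Π_{c ∈ μ, c ≠ (0,0)} (1 - q^(a'(c)) t^(l'(c)))`. -/
def PimuP {n : ℕ} (μ : n.Partition) : Kqt :=
  (((cellsP μ).filter (fun c => c ≠ (0, 0))).map (fun c => 1 - monQT c)).prod

/-! ## The algebra `Λ` of symmetric functions over `ℚ(q,t)`,
realized as polynomials in the power sums `p₁, p₂, …` -/

/-- `Λ`, the algebra of symmetric functions over `ℚ(q,t)`: the polynomial algebra on the
power sums `p_k`, `k ≥ 1`. -/
abbrev SymF : Type := MvPolynomial ℕ+ Kqt

/-- The power sum `p_k` for `k ≥ 1` (junk value `1` for `k = 0`). -/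
def ppSym (a : ℕ) : SymF := if h : 0 < a then X (⟨a, h⟩ : ℕ+) else 1

/-- `z_μ = Π_i i^{m_i(μ)} m_i(μ)!`. -/
def zmuP {n : ℕ} (μ : n.Partition) : Kqt :=
  (μ.parts.map (fun a => (a : Kqt))).prod *
    ∏ a ∈ μ.parts.toFinset, ((Nat.factorial (μ.parts.count a) : ℕ) : Kqt)

/-- The power sum product `p_μ`. -/
def pProdP {n : ℕ} (μ : n.Partition) : SymF := ((partsListP μ).map ppSym).prod

/-- The complete homogeneous symmetric function `h_n = Σ_{μ ⊢ n} p_μ / z_μ`. -/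
def hSym (n : ℕ) : SymF := ∑ μ : n.Partition, (zmuP μ)⁻¹ • pProdP μ

/-- The elementary symmetric function `e_n = Σ_{μ ⊢ n} (-1)^{n - ℓ(μ)} p_μ / z_μ`. -/
def eSym (n : ℕ) : SymF :=
  ∑ μ : n.Partition, ((-1 : Kqt) ^ (n - numPartsP μ) / zmuP μ) • pProdP μ

/-- `h_z` for an integer `z`: zero for negative `z`. -/
def hZ (z : ℤ) : SymF := if 0 ≤ z then hSym z.toNat else 0

/-- `e_z` for an integer `z`: zero for negative `z`. -/
def eZ (z : ℤ) : SymF := if 0 ≤ z then eSym z.toNat else 0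

/-- The Schur function `s_λ`, via the Jacobi–Trudi determinant
`s_λ = det (h_{λ_i - i + j})_{1 ≤ i,j ≤ ℓ(λ)}`. -/
def schurP {n : ℕ} (l : n.Partition) : SymF :=
  Matrix.det
    (Matrix.of fun i j : Fin (numPartsP l) =>
      hZ ((partOfP l i : ℤ) - (i : ℤ) + (j : ℤ)))

/-- The algebra endomorphism of `Λ` rescaling each power sum: `p_k ↦ c_k • p_k`.
This realizes plethystic substitutions `f[X A]` for alphabets `A` built from `q,t`. -/
def plScale (c : ℕ+ → Kqt) : SymF →ₐ[Kqt] SymF :=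
  aeval (fun k : ℕ+ => c k • (X k : SymF))

/-- The involution `ω`, determined by `p_k ↦ (-1)^(k-1) p_k` (it sends `e_k` to `h_k`). -/
def omegaSym : SymF →ₐ[Kqt] SymF := plScale (fun k => (-1 : Kqt) ^ ((k : ℕ) - 1))

/-- Plethysm `f[X(q-1)]`: `p_k ↦ (q^k - 1) p_k`. -/
def plQminus1 : SymF →ₐ[Kqt] SymF := plScale (fun k => qK ^ (k : ℕ) - 1)

/-- Plethysm `f[X(t-1)]`: `p_k ↦ (t^k - 1) p_k`. -/
def plTminus1 : SymF →ₐ[Kqt] SymF := plScale (fun k => tK ^ (k : ℕ) - 1)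

/-- Plethysm `f[X/(1-q)]`: `p_k ↦ p_k/(1 - q^k)`. -/
def plOneOverOneMinusQ : SymF →ₐ[Kqt] SymF := plScale (fun k => (1 - qK ^ (k : ℕ))⁻¹)

/-- Plethysm `f[X(1-q^m)/(1-q)]`: `p_k ↦ ((1 - q^(km))/(1 - q^k)) p_k`. -/
def plXqZ (m : ℤ) : SymF →ₐ[Kqt] SymF :=
  plScale (fun k => (1 - qK ^ ((k : ℕ) * m.toNat)) / (1 - qK ^ (k : ℕ)))

/-- Plethysm `f[X/M]` with `M = (1-q)(1-t)`: `p_k ↦ p_k/((1-q^k)(1-t^k))`. -/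
def plXoverM : SymF →ₐ[Kqt] SymF :=
  plScale (fun k => ((1 - qK ^ (k : ℕ)) * (1 - tK ^ (k : ℕ)))⁻¹)

/-- `z`-weight of an exponent vector, so that `⟨p_λ, p_μ⟩ = δ_{λμ} z_λ`. -/
def zzH (d : ℕ+ →₀ ℕ) : Kqt :=
  ∏ i ∈ d.support, (((i : ℕ+) : ℕ) : Kqt) ^ d i * ((Nat.factorial (d i) : ℕ) : Kqt)

/-- The Hall scalar product on `Λ`, in power sum coordinates. -/
def hallH (f g : SymF) : Kqt :=
  ∑ d ∈ f.support, MvPolynomial.coeff d f * MvPolynomial.coeff d g * zzH d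

/-- Plethystic evaluation of `f ∈ Λ` at a finite alphabet of monomials
`q^α t^β` (given as a list of pairs `(α, β)`); `p_k` evaluates to `Σ q^(kα) t^(kβ)`. -/
def evalPl (S : List (ℕ × ℕ)) : SymF →ₐ[Kqt] Kqt :=
  aeval (fun k : ℕ+ => (S.map (fun c => qK ^ ((k : ℕ) * c.1) * tK ^ ((k : ℕ) * c.2))).sum)

/-! ## The modified Macdonald basis and the operators `∇`, `Δ_f`, `Δ'_f` -/

/-- Dominance order: `l ⊵ μ`. -/
def dominatesP {n : ℕ} (l μ : n.Partition) : Prop :=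
  ∀ i, ∑ r ∈ range (i + 1), partOfP μ r ≤ ∑ r ∈ range (i + 1), partOfP l r

/-- `l` dominates the conjugate partition `μ'` of `μ`. -/
def dominatesConjP {n : ℕ} (l μ : n.Partition) : Prop :=
  ∀ i, ∑ r ∈ range (i + 1), conjPartP μ r ≤ ∑ r ∈ range (i + 1), partOfP l r

/-- The characterizing axioms of the modified Macdonald polynomials `H̃_μ[X;q,t]`:
`H̃_μ[X(q-1)] ∈ span{s_λ : λ ⊵ μ'}`, `H̃_μ[X(t-1)] ∈ span{s_λ : λ ⊵ μ}`, and
`⟨H̃_μ, s_(n)⟩ = 1` (where `s_(n) = h_n`). -/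
def IsMacdonaldBasis (H : ∀ n : ℕ, n.Partition → SymF) : Prop :=
  ∀ (n : ℕ) (μ : n.Partition),
    plQminus1 (H n μ) ∈
        Submodule.span Kqt ((fun l => schurP l) '' {l : n.Partition | dominatesConjP l μ}) ∧
    plTminus1 (H n μ) ∈
        Submodule.span Kqt ((fun l => schurP l) '' {l : n.Partition | dominatesP l μ}) ∧
    hallH (H n μ) (hSym n) = 1

/-- `Δ` is the Delta operator family for the Macdonald basis `H`:
`Δ_f H̃_μ = f[B_μ] H̃_μ`. -/
def IsDeltaOp (H : ∀ n : ℕ, n.Partition → SymF)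
    (Δ : SymF → Module.End Kqt SymF) : Prop :=
  ∀ (f : SymF) (n : ℕ) (μ : n.Partition), Δ f (H n μ) = evalPl (cellsP μ) f • H n μ

/-- `Δ'` is the primed Delta operator family for the Macdonald basis `H`:
`Δ'_f H̃_μ = f[B_μ - 1] H̃_μ`. -/
def IsDeltaPrimeOp (H : ∀ n : ℕ, n.Partition → SymF)
    (Δ' : SymF → Module.End Kqt SymF) : Prop :=
  ∀ (f : SymF) (n : ℕ) (μ : n.Partition),
    Δ' f (H n μ) = evalPl ((cellsP μ).erase (0, 0)) f • H n μ

/-- `nab` is the `∇` operator for the Macdonald basis `H`: `∇ H̃_μ = T_μ H̃_μ`. -/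
def IsNablaOp (H : ∀ n : ℕ, n.Partition → SymF) (nab : Module.End Kqt SymF) : Prop :=
  ∀ (n : ℕ) (μ : n.Partition), nab (H n μ) = TmuP μ • H n μ

/-! ## Specializations at `t = 0` and `q = 0` -/

/-- The substitution `t ↦ 0` on `ℚ[q,t]`. -/
def evT0R : Rqt →+* Rqt :=
  (aeval (fun i : Fin 2 => if i = 0 then (X 0 : Rqt) else 0)).toRingHom

/-- The substitution `q ↦ 0` on `ℚ[q,t]`. -/
def evQ0R : Rqt →+* Rqt :=
  (aeval (fun i : Fin 2 => if i = 1 then (X 1 : Rqt) else 0)).toRingHom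

/-- Specialization of an element of `ℚ(q,t)` along a substitution of `ℚ[q,t]`:
write it as a fraction whose denominator does not specialize to zero, and specialize
numerator and denominator (junk value `0` if no such fraction exists). -/
def specK (ev : Rqt →+* Rqt) (x : Kqt) : Kqt :=
  if h : ∃ ab : Rqt × Rqt,
      x = algebraMap Rqt Kqt ab.1 / algebraMap Rqt Kqt ab.2 ∧ ev ab.2 ≠ 0 then
    algebraMap Rqt Kqt (ev h.choose.1) / algebraMap Rqt Kqt (ev h.choose.2)
  else 0

/-- Coefficientwise specialization on `Λ`. -/
def specSym (ev : Rqt →+* Rqt) (f : SymF) : SymF :=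
  ∑ d ∈ f.support, MvPolynomial.monomial d (specK ev (MvPolynomial.coeff d f))

/-- Specialization `t = 0` on `Λ`. -/
def atT0 : SymF → SymF := specSym evT0R

/-- Specialization `q = 0` on `Λ`. -/
def atQ0 : SymF → SymF := specSym evQ0R

/-- Specialization `q = 0` on `ℚ(q,t)`. -/
def atQ0K : Kqt → Kqt := specK evQ0R

/-- `(∇ e_n)|_{t=0} = h_n[X/(1-q)] ∏_{i=1}^n (1 - q^i)`. -/
def nablaEnT0 (n : ℕ) : SymF :=
  (∏ i ∈ range n, (1 - qK ^ (i + 1))) • plOneOverOneMinusQ (hSym n)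

/-! ## The families `F_{n,k;p}^{(d,ℓ)}` and `S_{n,k;p}^{(d,ℓ)}` -/

/-- `F_{n,k;p}^{(d,ℓ)} = t^{n-k-ℓ} ⟨Δ_{h_{n-k-ℓ}} Δ_{e_ℓ} e_{n+p-d}[X(1-q^k)/(1-q)], e_p h_{n-d}⟩`. -/
def Ffam (Δ : SymF → Module.End Kqt SymF) (n k p d l : ℤ) : Kqt :=
  tK ^ (n - k - l) *
    hallH (Δ (hZ (n - k - l)) (Δ (eZ l) (plXqZ k (eZ (n + p - d)))))
      (eZ p * hZ (n - d))

/-- `S_{n,k;p}^{(d,ℓ)} = ([n]_q/[k]_q) F_{n,k;p}^{(d,ℓ)}` (for `k ≥ 1`; the degenerate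
value at `k = 0` is given by the initial conditions). -/
def Sfam (Δ : SymF → Module.End Kqt SymF) (n k p d l : ℤ) : Kqt :=
  if k = 0 then (if n = 0 ∧ p = 0 ∧ d = 0 ∧ l = 0 then 1 else 0)
  else (qaZ qK n / qaZ qK k) * Ffam Δ n k p d l

/-! ## Lattice path combinatorics

A north/east lattice path from `(0,0)` to `(N,N)` whose `i`-th vertical step (0-indexed,
from the bottom) starts on the diagonal `y = x + a i` is encoded by its area word
`a : Fin N → ℤ`. -/

/-- `a` is the area word of a square path ending east: the first vertical step starts in
column `≥ 0`, columns of vertical steps weakly increase, and the last step is east. -/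
def isPathEE {N : ℕ} (a : Fin N → ℤ) : Prop :=
  (∀ i : Fin N, (i : ℕ) = 0 → a i ≤ 0) ∧
  (∀ i j : Fin N, (j : ℕ) = (i : ℕ) + 1 → a j ≤ a i + 1) ∧
  (∀ i : Fin N, (i : ℕ) = N - 1 → 0 ≤ a i)

/-- `a` is the area word of a Dyck path. -/
def isDyckA {N : ℕ} (a : Fin N → ℤ) : Prop :=
  (∀ i : Fin N, (i : ℕ) = 0 → a i = 0) ∧
  (∀ i j : Fin N, (j : ℕ) = (i : ℕ) + 1 → a j ≤ a i + 1) ∧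
  (∀ i : Fin N, 0 ≤ a i)

/-- The vertical step `i` is a rise: it is directly preceded by a vertical step. -/
def isRiseA {N : ℕ} (a : Fin N → ℤ) (i : Fin N) : Prop :=
  ∃ j : Fin N, (i : ℕ) = (j : ℕ) + 1 ∧ a i = a j + 1

/-- The vertical step `i` is a peak: it is followed by a horizontal step
(the last vertical step is always a peak). -/
def isPeakA {N : ℕ} (a : Fin N → ℤ) (i : Fin N) : Prop :=
  ((i : ℕ) = N - 1) ∨ ∃ j : Fin N, (j : ℕ) = (i : ℕ) + 1 ∧ a j ≤ a i

/-- The vertical step `i` is a valley: it is directly preceded by a horizontal step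
(including a first vertical step preceded by east steps). -/
def isValleyA {N : ℕ} (a : Fin N → ℤ) (i : Fin N) : Prop :=
  ((i : ℕ) = 0 ∧ a i < 0) ∨ ∃ j : Fin N, (i : ℕ) = (j : ℕ) + 1 ∧ a i ≤ a j

/-- The minimal letter of the area word (the base diagonal is `y = x + minA a`). -/
def minA {N : ℕ} (a : Fin N → ℤ) : ℤ :=
  if h : N = 0 then 0
  else Finset.inf' Finset.univ ⟨⟨0, Nat.pos_of_ne_zero h⟩, Finset.mem_univ _⟩ a

/-- The area of a decorated square path: whole squares between the path and the base
diagonal, discarding rows with a decorated rise. -/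
def areaSq {N : ℕ} (a : Fin N → ℤ) (dr : Finset (Fin N)) : ℤ :=
  ∑ i ∈ Finset.univ.filter (fun i => i ∉ dr), (a i - minA a)

/-- The area of a decorated Dyck path. -/
def areaD {N : ℕ} (a : Fin N → ℤ) (dr : Finset (Fin N)) : ℤ :=
  ∑ i ∈ Finset.univ.filter (fun i => i ∉ dr), a i

/-- Primary and secondary inversions of a labelled path (labels `0` are zero labels). -/
def dinvPairs {N : ℕ} (a : Fin N → ℤ) (l : Fin N → ℕ) : ℕ :=
  (Finset.univ.filter (fun ij : Fin N × Fin N =>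
      ij.1 < ij.2 ∧ a ij.1 = a ij.2 ∧ l ij.1 < l ij.2)).card +
  (Finset.univ.filter (fun ij : Fin N × Fin N =>
      ij.1 < ij.2 ∧ a ij.1 = a ij.2 + 1 ∧ l ij.2 < l ij.1)).card

/-- Bonus dinv of a labelled square path: rows strictly below the main diagonal with
nonzero label. -/
def bonusLab {N : ℕ} (a : Fin N → ℤ) (l : Fin N → ℕ) : ℕ :=
  (Finset.univ.filter (fun i : Fin N => a i < 0 ∧ l i ≠ 0)).card

/-- The dinv of a partially labelled square path ending east. -/
def dinvSqLab {N : ℕ} (a : Fin N → ℤ) (l : Fin N → ℕ) : ℕ :=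
  dinvPairs a l + bonusLab a l

/-- The dinv of a square path with decorated peaks `dp` and zero valleys `zv`. -/
def dinvDec {N : ℕ} (a : Fin N → ℤ) (dp zv : Finset (Fin N)) : ℕ :=
  (Finset.univ.filter (fun ij : Fin N × Fin N =>
      ij.1 < ij.2 ∧ a ij.1 = a ij.2 ∧ ij.1 ∉ dp ∧ ij.2 ∉ zv)).card +
  (Finset.univ.filter (fun ij : Fin N × Fin N =>
      ij.1 < ij.2 ∧ a ij.1 = a ij.2 + 1 ∧ ij.2 ∉ dp ∧ ij.1 ∉ zv)).card +
  (Finset.univ.filter (fun i : Fin N => a i < 0 ∧ i ∉ zv)).card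

/-- Labels are strictly increasing in each column (bottom to top). -/
def colIncr {N : ℕ} (a : Fin N → ℤ) (l : Fin N → ℕ) : Prop :=
  ∀ i j : Fin N, (j : ℕ) = (i : ℕ) + 1 → a j = a i + 1 → l i < l j

/-- The monomial `x^P` of a labelling: label `j+1` contributes the variable `x_j`,
label `0` contributes nothing. -/
def xmon (V : ℕ) {N : ℕ} (l : Fin N → ℕ) : MvPolynomial (Fin V) Kqt :=
  ∏ i : Fin N, (if h : 0 < l i ∧ l i - 1 < V then (X (⟨l i - 1, h.2⟩ : Fin V)) else 1)

/-- The generating function `PLD_{x,qq,tt}(m,n)^{*k}` of partially labelled decorated Dyck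
paths with `m` zero labels, `n` nonzero labels and `k` decorated rises, truncated to the
label alphabet `{1, …, V}`. -/
def PLDgf (qq tt : Kqt) (V m n k : ℕ) : MvPolynomial (Fin V) Kqt :=
  ∑ a ∈ Fintype.piFinset (fun _ : Fin (m + n) => Finset.Icc (-((m + n : ℕ) : ℤ)) ((m + n : ℕ) : ℤ)),
    ∑ l ∈ Fintype.piFinset (fun _ : Fin (m + n) => Finset.range (V + 1)),
      ∑ dr ∈ (Finset.univ : Finset (Fin (m + n))).powerset,
        if isDyckA a ∧ colIncr a l ∧
            (Finset.univ.filter (fun i => l i = 0)).card = m ∧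
            (∀ i : Fin (m + n), a i = (i : ℕ) → l i ≠ 0) ∧
            (∀ i ∈ dr, isRiseA a i) ∧ dr.card = k then
          (qq ^ dinvPairs a l * tt ^ (areaD a dr).toNat) • xmon V l
        else 0

/-- The generating function `PLSQ^E_{x,qq,tt}(m,n)^{*k}` of partially labelled decorated
square paths ending east with `m` zero labels, `n` nonzero labels and `k` decorated
rises, truncated to the label alphabet `{1, …, V}`. -/
def PLSQgf (qq tt : Kqt) (V m n k : ℕ) : MvPolynomial (Fin V) Kqt :=
  ∑ a ∈ Fintype.piFinset (fun _ : Fin (m + n) => Finset.Icc (-((m + n : ℕ) : ℤ)) ((m + n : ℕ) : ℤ)),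
    ∑ l ∈ Fintype.piFinset (fun _ : Fin (m + n) => Finset.range (V + 1)),
      ∑ dr ∈ (Finset.univ : Finset (Fin (m + n))).powerset,
        if isPathEE a ∧ colIncr a l ∧
            (Finset.univ.filter (fun i => l i = 0)).card = m ∧
            (∀ i : Fin (m + n), l i = 0 → isValleyA a i) ∧
            (∃ i : Fin (m + n), a i = minA a ∧ l i ≠ 0) ∧
            (∀ i : Fin (m + n), (i : ℕ) = 0 → a i = 0 → l i ≠ 0) ∧
            (∀ i ∈ dr, isRiseA a i) ∧ dr.card = k then
          (qq ^ dinvSqLab a l * tt ^ (areaSq a dr).toNat) • xmon V l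
        else 0

/-- The valid configurations of `SQE(p,n)^{*ℓ,∘d}`: a square path ending east of size
`n+p` with `ℓ` decorated rises `dr`, `d` decorated peaks `dp`, and `p` zero valleys `zv`. -/
def isSQEdec (p n l d : ℕ) (a : Fin (n + p) → ℤ) (dr dp zv : Finset (Fin (n + p))) : Prop :=
  isPathEE a ∧
  (∀ i ∈ dr, isRiseA a i) ∧ dr.card = l ∧
  (∀ i ∈ dp, isPeakA a i) ∧ dp.card = d ∧
  (∀ i ∈ zv, isValleyA a i) ∧ zv.card = p ∧
  dp ∩ zv = ∅ ∧
  (∃ i : Fin (n + p), a i = minA a ∧ i ∉ zv)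

/-- `SQE_{q,t}(p, n∖k)^{*ℓ,∘d}`: the `q,t`-generating polynomial of decorated square
paths ending east with exactly `k` non-zero-valley steps on the base diagonal. -/
def SQEk (p n k l d : ℕ) : Kqt :=
  ∑ a ∈ Fintype.piFinset (fun _ : Fin (n + p) => Finset.Icc (-((n + p : ℕ) : ℤ)) ((n + p : ℕ) : ℤ)),
    ∑ dr ∈ (Finset.univ : Finset (Fin (n + p))).powerset,
      ∑ dp ∈ (Finset.univ : Finset (Fin (n + p))).powerset,
        ∑ zv ∈ (Finset.univ : Finset (Fin (n + p))).powerset,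
          if isSQEdec p n l d a dr dp zv ∧
              (Finset.univ.filter (fun i : Fin (n + p) => a i = minA a ∧ i ∉ zv)).card = k then
            qK ^ dinvDec a dp zv * tK ^ (areaSq a dr).toNat
          else 0

/-- `SQE_{q,t}(p, n)^{*ℓ,∘d}`: the `q,t`-generating polynomial of all decorated square
paths ending east. -/
def SQEall (p n l d : ℕ) : Kqt :=
  ∑ a ∈ Fintype.piFinset (fun _ : Fin (n + p) => Finset.Icc (-((n + p : ℕ) : ℤ)) ((n + p : ℕ) : ℤ)),
    ∑ dr ∈ (Finset.univ : Finset (Fin (n + p))).powerset,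
      ∑ dp ∈ (Finset.univ : Finset (Fin (n + p))).powerset,
        ∑ zv ∈ (Finset.univ : Finset (Fin (n + p))).powerset,
          if isSQEdec p n l d a dr dp zv then
            qK ^ dinvDec a dp zv * tK ^ (areaSq a dr).toNat
          else 0

/-- The evaluation of a symmetric function at the finite alphabet `x_1, …, x_V`:
`p_k ↦ x_1^k + ⋯ + x_V^k`. -/
def pKV (V : ℕ) : SymF →ₐ[Kqt] MvPolynomial (Fin V) Kqt :=
  aeval (fun k : ℕ+ => ∑ i : Fin V, (X i : MvPolynomial (Fin V) Kqt) ^ (k : ℕ))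

/-- The monomial symmetric function `m_μ(x_1, …, x_V)`. -/
def msymFin (V : ℕ) {n : ℕ} (μ : n.Partition) : MvPolynomial (Fin V) Kqt :=
  ∑ f ∈ Fintype.piFinset (fun _ : Fin V => Finset.range (n + 1)),
    if (Finset.univ.val.map f).filter (fun x => x ≠ 0) = μ.parts then
      ∏ i : Fin V, (X i : MvPolynomial (Fin V) Kqt) ^ f i
    else 0

/-- The `q`-multinomial coefficient `[n; μ₁, …, μ_ℓ]_q`. -/
def qmultinomP {n : ℕ} (μ : n.Partition) : Kqt :=
  qfacK qK n / ((partsListP μ).map (fun a => qfacK qK a)).prod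


/-- The alternating sum is a product over the multiset. -/
theorem aux_prod_esymm (t : Kqt) (S : Multiset Kqt) :
    ∑ s ∈ range (Multiset.card S + 1), (-t) ^ s * S.esymm (Multiset.card S - s) =
      (S.map (fun r => r - t)).prod := by
  have h := congrArg (Polynomial.eval (-t)) (Multiset.prod_X_add_C_eq_sum_esymm S)
  rw [Polynomial.eval_multiset_prod, Multiset.map_map, Polynomial.eval_finsetSum] at h
  have h2 : (S.map (fun r => r - t)).prod =
      (S.map ((Polynomial.eval (-t)) ∘ fun r => Polynomial.X + Polynomial.C r)).prod := by
    congr 1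
    apply Multiset.map_congr rfl
    intro r _
    simp only [Function.comp, Polynomial.eval_add, Polynomial.eval_X, Polynomial.eval_C]
    ring
  rw [h2, h, ← Finset.sum_range_reflect]
  apply Finset.sum_congr rfl
  intro j hj
  have hj' : j ≤ Multiset.card S := by
    have := Finset.mem_range.mp hj
    omega
  have e1 : Multiset.card S + 1 - 1 - j = Multiset.card S - j := by omega
  have e2 : Multiset.card S - (Multiset.card S - j) = j := by omega
  simp only [e1, e2, Polynomial.eval_mul, Polynomial.eval_C, Polynomial.eval_pow,
    Polynomial.eval_X]
  ring

theorem aux_partsList_length {n : ℕ} (μ : n.Partition) :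
    (partsListP μ).length = numPartsP μ := by
  simp [partsListP, numPartsP]

theorem aux_partsList_sum {n : ℕ} (μ : n.Partition) : (partsListP μ).sum = n := by
  have h : ((partsListP μ : List ℕ) : Multiset ℕ) = μ.parts := by
    simp [partsListP]
  rw [← Multiset.sum_coe, h, μ.parts_sum]

theorem aux_map_getD (l : List ℕ) :
    (List.range l.length).map (fun r => l.getD r 0) = l := by
  apply List.ext_getElem
  · simp
  · intro i h1 h2
    simp [List.getElem?_eq_getElem h2]

theorem aux_cells_length {n : ℕ} (μ : n.Partition) : (cellsP μ).length = n := by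
  rw [cellsP, List.length_flatMap]
  simp only [List.length_map, List.length_range]
  have h := aux_map_getD (partsListP μ)
  rw [aux_partsList_length] at h
  have h2 : (List.range (numPartsP μ)).map (fun r => partOfP μ r) = partsListP μ := h
  rw [h2, aux_partsList_sum]

/-- For `n ≥ 1` and `μ ⊢ n`,
`Σ_{s=0}^{n} (-t)^s e_{n-s}[B_μ]` equals `∏_{i=0}^{n-1} (q^i - t)` if `μ = (n)`,
and `0` for every other partition `μ` of `n`. -/
theorem delta_square_stmt0 (n : ℕ) (hn : 1 ≤ n) (μ : n.Partition) :
    ∑ s ∈ range (n + 1),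
        (-tK) ^ s * Multiset.esymm (↑((cellsP μ).map monQT) : Multiset Kqt) (n - s) =
      if μ.parts = {n} then ∏ i ∈ range n, (qK ^ i - tK) else 0 := by
  have hc : Multiset.card (↑((cellsP μ).map monQT) : Multiset Kqt) = n := by
    rw [Multiset.coe_card, List.length_map, aux_cells_length]
  have key := aux_prod_esymm tK (↑((cellsP μ).map monQT) : Multiset Kqt)
  rw [hc] at key
  rw [key, Multiset.map_coe, Multiset.prod_coe, List.map_map]
  split_ifs with h
  · have hp : partsListP μ = [n] := by simp [partsListP, h]
    have hnum : numPartsP μ = 1 := by simp [numPartsP, h]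
    have hpart : partOfP μ 0 = n := by simp [partOfP, hp]
    have hcells : cellsP μ = (List.range n).map (fun c => (c, 0)) := by
      simp [cellsP, hnum, hpart, List.range_succ]
    rw [hcells, List.map_map, Finset.prod_range, ← List.prod_ofFn]
    congr 1
    apply List.ext_getElem
    · simp
    · intro i h1 h2
      simp [monQT]
  · apply List.prod_eq_zero
    have hnum : 2 ≤ numPartsP μ := by
      by_contra hlt
      have hsum := μ.parts_sum
      have : numPartsP μ = 0 ∨ numPartsP μ = 1 := by omega
      rcases this with h0 | h1
      · have h0' := Multiset.card_eq_zero.mp h0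
        rw [h0'] at hsum
        simp at hsum
        omega
      · obtain ⟨a, ha⟩ := Multiset.card_eq_one.mp h1
        rw [ha, Multiset.sum_singleton] at hsum
        exact h (by rw [ha, hsum])
    have hlen : 1 < (partsListP μ).length := by rw [aux_partsList_length]; omega
    have hpos : 0 < partOfP μ 1 := by
      rw [partOfP, List.getD_eq_getElem _ _ hlen]
      apply μ.parts_pos
      have hm := List.getElem_mem hlen
      have hiff : ∀ x, x ∈ partsListP μ → x ∈ μ.parts := by
        intro x hx
        simpa [partsListP] using hx
      exact hiff _ hm
    have hmem : ((0, 1) : ℕ × ℕ) ∈ cellsP μ := by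
      simp only [cellsP, List.mem_flatMap, List.mem_map, List.mem_range]
      exact ⟨1, by omega, 0, hpos, rfl⟩
    refine List.mem_map.mpr ⟨(0, 1), hmem, ?_⟩
    simp [monQT]

end
end

section
/- For m ≥ 0 and n ≥ 1, Σ_{s=0}^{n−1} (−t)^s PLSQ^E_{x,q,t}(m,n)^{*s} = PLD_{x,q,0}(m,n)^{*0}, and Σ_{s=0}^{n−1} (−t)^s PLD_{x,q,t}(m,n)^{*s} = PLD_{x,q,0}(m,n)^{*0}. -/
open scoped Classical
open MvPolynomial Finset

noncomputable section

/-- Signed sum over decorations factors as a product over rows. -/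
lemma key_sum {M : Type*} [AddCommGroup M] [Module Kqt M] {N : ℕ} (n : ℕ) (P : Prop)
    (R : Fin N → Prop)
    (hc : P → ∀ dr : Finset (Fin N), (∀ i ∈ dr, R i) → dr.card < n)
    (b : Fin N → ℤ) (hb : P → ∀ i, 0 ≤ b i) (t c : Kqt) (x : M) :
    (∑ s ∈ range n, (-t) ^ s • ∑ dr ∈ (Finset.univ : Finset (Fin N)).powerset,
      if P ∧ (∀ i ∈ dr, R i) ∧ dr.card = s then
        (c * t ^ (∑ i ∈ Finset.univ.filter (fun i => i ∉ dr), b i).toNat) • x else 0) =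
    if P then (∏ i : Fin N, ((if R i then -t else 0) + t ^ (b i).toNat)) • (c • x) else 0 := by
  by_cases hP : P
  swap
  · simp [hP]
  have hc := hc hP
  have hb := hb hP
  simp only [hP, true_and, if_true]
  rw [Finset.prod_add, Finset.sum_smul]
  simp only [Finset.smul_sum]
  rw [Finset.sum_comm]
  refine Finset.sum_congr rfl fun dr _ => ?_
  by_cases hR : ∀ i ∈ dr, R i
  · have h1 : ∏ i ∈ dr, (if R i then -t else 0) = (-t) ^ dr.card := by
      rw [Finset.prod_congr rfl (fun i hi => if_pos (hR i hi)), Finset.prod_const]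
    have h2 : (∑ i ∈ Finset.univ.filter (fun i => i ∉ dr), b i).toNat
        = ∑ i ∈ Finset.univ \ dr, (b i).toNat := by
      have : (Finset.univ.filter (fun i => i ∉ dr)) = Finset.univ \ dr := by
        ext i; simp
      rw [this]
      zify
      rw [Int.toNat_of_nonneg (Finset.sum_nonneg fun i _ => hb i)]
      exact Finset.sum_congr rfl fun i _ => by
        have := hb i
        omega
    rw [h1, h2, Finset.prod_pow_eq_pow_sum]
    rw [Finset.sum_eq_single dr.card]
    · rw [if_pos ⟨hR, rfl⟩, smul_smul, smul_smul]
      congr 1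
      ring
    · intro s _ hs
      rw [if_neg (fun h => hs h.2.symm), smul_zero]
    · intro h
      exact absurd (Finset.mem_range.2 (hc dr hR)) h
  · have h1 : ∏ i ∈ dr, (if R i then -t else 0) = 0 := by
      push Not at hR
      obtain ⟨i, hi, hi2⟩ := hR
      exact Finset.prod_eq_zero hi (if_neg hi2)
    simp [h1, hR]

/-- The product vanishes as soon as a rise has weight one. -/
lemma prod_zero_of_rise {N : ℕ} (R : Fin N → Prop) (b : Fin N → ℤ) (t : Kqt)
    (i : Fin N) (hi : R i) (hbi : b i = 1) :
    (∏ i : Fin N, ((if R i then -t else 0) + t ^ (b i).toNat)) = 0 := by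
  apply Finset.prod_eq_zero (Finset.mem_univ i)
  simp [hi, hbi]

/-- If all rises carry nonzero labels and one non-rise carries a nonzero label,
then there are fewer than `n` rises. -/
lemma card_rises_lt {m n : ℕ} (R : Fin (m + n) → Prop) (l : Fin (m + n) → ℕ)
    (hm : (Finset.univ.filter (fun i => l i = 0)).card = m)
    (hR : ∀ i, R i → l i ≠ 0) (i0 : Fin (m + n)) (h0 : ¬ R i0) (hl0 : l i0 ≠ 0)
    (dr : Finset (Fin (m + n))) (hdr : ∀ i ∈ dr, R i) : dr.card < n := by
  have h1 := Finset.card_filter_add_card_filter_not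
    (s := (Finset.univ : Finset (Fin (m + n)))) (fun i => l i = 0)
  rw [hm, Finset.card_univ, Fintype.card_fin] at h1
  have h2 : (Finset.univ.filter (fun i => ¬ l i = 0)).card = n := by omega
  refine lt_of_lt_of_eq (Finset.card_lt_card ?_) h2
  refine ⟨fun i hi => by simpa using hR i (hdr i hi), fun h => ?_⟩
  exact h0 (hdr i0 (h (by simpa using hl0)))

lemma rise_label {N : ℕ} (a : Fin N → ℤ) (l : Fin N → ℕ) (h : colIncr a l) (i : Fin N)
    (hi : isRiseA a i) : l i ≠ 0 := by
  obtain ⟨j, hj, hj2⟩ := hi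
  have := h j i hj hj2
  omega

/-- A path that is above the base level somewhere after a point of the base level
has a rise directly above the base level. -/
lemma exists_rise {N : ℕ} (a : Fin N → ℤ)
    (hs : ∀ i j : Fin N, (j : ℕ) = (i : ℕ) + 1 → a j ≤ a i + 1) (c : ℤ)
    (hc : ∀ i, c ≤ a i) (i0 : Fin N) (h0 : a i0 = c) (d : ℕ) :
    ∀ i1 : Fin N, (i1 : ℕ) = (i0 : ℕ) + d → c < a i1 → ∃ i, isRiseA a i ∧ a i = c + 1 := by
  induction d with
  | zero =>
    intro i1 h h1
    have : i1 = i0 := Fin.ext (by simpa using h)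
    subst this
    omega
  | succ d ih =>
    intro i1 h h1
    have hlt : (i0 : ℕ) + d < N := by have := i1.2; omega
    let j : Fin N := ⟨(i0 : ℕ) + d, hlt⟩
    have hj : (i1 : ℕ) = (j : ℕ) + 1 := by simp [j]; omega
    by_cases hjc : c < a j
    · exact ih j rfl hjc
    · have e1 := hc j
      have e2 := hs j i1 hj
      exact ⟨i1, ⟨j, hj, by omega⟩, by omega⟩

lemma minA_le {N : ℕ} (a : Fin N → ℤ) (i : Fin N) : minA a ≤ a i := by
  have hN : N ≠ 0 := by have := i.2; omega
  rw [minA, dif_neg hN]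
  exact Finset.inf'_le _ (Finset.mem_univ i)

/-- Common value of the `(a,l)` contribution on both sides. -/
def Zterm (V m n : ℕ) (a : Fin (m + n) → ℤ) (l : Fin (m + n) → ℕ) :
    MvPolynomial (Fin V) Kqt :=
  if a = 0 ∧ (Finset.univ.filter (fun i => l i = 0)).card = m ∧
      (∀ i : Fin (m + n), (i : ℕ) = 0 → l i ≠ 0) then
    (qK ^ dinvPairs a l) • xmon V l else 0

lemma dyck_zero {N : ℕ} : isDyckA (0 : Fin N → ℤ) :=
  ⟨fun _ _ => rfl, fun _ _ _ => by simp, fun _ => le_rfl⟩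

lemma colIncr_zero {N : ℕ} (l : Fin N → ℕ) : colIncr (0 : Fin N → ℤ) l := by
  intro i j _ h
  simp at h

lemma not_rise_zero {N : ℕ} (i : Fin N) : ¬ isRiseA (0 : Fin N → ℤ) i := by
  rintro ⟨j, _, h⟩
  simp at h

lemma dyck_prod {N : ℕ} (hN : 0 < N) (a : Fin N → ℤ) (h : isDyckA a) (ha : a ≠ 0) (t : Kqt) :
    (∏ i : Fin N, ((if isRiseA a i then -t else 0) + t ^ (a i).toNat)) = 0 := by
  obtain ⟨i1, hi1⟩ := Function.ne_iff.1 ha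
  have hp : 0 < a i1 := lt_of_le_of_ne (h.2.2 i1) (fun e => hi1 e.symm)
  obtain ⟨i, hi, hi2⟩ := exists_rise a h.2.1 0 h.2.2 ⟨0, hN⟩ (h.1 _ rfl) i1 i1 (by simp) hp
  exact prod_zero_of_rise _ _ t i hi (by simpa using hi2)

lemma pld_term (V m n : ℕ) (hn : 1 ≤ n) (a : Fin (m + n) → ℤ) (l : Fin (m + n) → ℕ) :
    (∑ s ∈ range n, (-tK) ^ s • ∑ dr ∈ (Finset.univ : Finset (Fin (m + n))).powerset,
        if isDyckA a ∧ colIncr a l ∧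
            (Finset.univ.filter (fun i => l i = 0)).card = m ∧
            (∀ i : Fin (m + n), a i = (i : ℕ) → l i ≠ 0) ∧
            (∀ i ∈ dr, isRiseA a i) ∧ dr.card = s then
          (qK ^ dinvPairs a l * tK ^ (areaD a dr).toNat) • xmon V l
        else 0) = Zterm V m n a l := by
  have hN : 0 < m + n := by omega
  have := key_sum n (isDyckA a ∧ colIncr a l ∧
            (Finset.univ.filter (fun i => l i = 0)).card = m ∧
            (∀ i : Fin (m + n), a i = (i : ℕ) → l i ≠ 0)) (isRiseA a) ?_ a ?_ tK
            (qK ^ dinvPairs a l) (xmon V l)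
  · simp only [and_assoc] at this
    unfold areaD
    rw [this, Zterm]
    by_cases ha : a = 0
    · subst ha
      simp only [dyck_zero, colIncr_zero, true_and, not_rise_zero]
      have e : (∀ i : Fin (m + n), (0 : Fin (m + n) → ℤ) i = (i : ℕ) → l i ≠ 0) ↔
          (∀ i : Fin (m + n), (i : ℕ) = 0 → l i ≠ 0) := by
        refine forall_congr' fun i => ?_
        simp only [Pi.zero_apply]
        constructor <;> intro h h' <;> exact h (by omega)
      simp only [e]
      simp
    · rw [if_neg (fun h : a = 0 ∧ _ => ha h.1)]
      split_ifs with h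
      · rw [dyck_prod hN a h.1 ha, zero_smul]
      · rfl
  · rintro ⟨h1, h2, h3, h4⟩ dr hdr
    refine card_rises_lt (isRiseA a) l h3 (fun i => rise_label a l h2 i) ⟨0, hN⟩ ?_ ?_ dr hdr
    · rintro ⟨j, hj, _⟩
      simp at hj
    · exact h4 _ (by simpa using h1.1 ⟨0, hN⟩ rfl)
  · rintro ⟨h1, _⟩
    exact h1.2.2

lemma pld0_term (V m n : ℕ) (a : Fin (m + n) → ℤ) (l : Fin (m + n) → ℕ) :
    (∑ dr ∈ (Finset.univ : Finset (Fin (m + n))).powerset,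
        if isDyckA a ∧ colIncr a l ∧
            (Finset.univ.filter (fun i => l i = 0)).card = m ∧
            (∀ i : Fin (m + n), a i = (i : ℕ) → l i ≠ 0) ∧
            (∀ i ∈ dr, isRiseA a i) ∧ dr.card = 0 then
          (qK ^ dinvPairs a l * (0 : Kqt) ^ (areaD a dr).toNat) • xmon V l
        else 0) = Zterm V m n a l := by
  rw [Finset.sum_eq_single ∅]
  rotate_left
  · intro dr _ h
    rw [if_neg]
    intro h'
    exact h (Finset.card_eq_zero.1 h'.2.2.2.2.2)
  · intro h
    simp at h
  rw [Zterm]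
  by_cases ha : a = 0
  · subst ha
    have e : (∀ i : Fin (m + n), (0 : Fin (m + n) → ℤ) i = (i : ℕ) → l i ≠ 0) ↔
        (∀ i : Fin (m + n), (i : ℕ) = 0 → l i ≠ 0) := by
      refine forall_congr' fun i => ?_
      simp only [Pi.zero_apply]
      constructor <;> intro h h' <;> exact h (by omega)
    simp only [e]
    simp [dyck_zero, colIncr_zero, areaD]
  · rw [if_neg (fun h : a = 0 ∧ _ => ha h.1)]
    split_ifs with h
    · obtain ⟨i1, hi1⟩ := Function.ne_iff.1 ha
      have hd := h.1.2.2
      have hp : 0 < a i1 := lt_of_le_of_ne (hd i1) (fun e => hi1 e.symm)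
      have : 0 < areaD a ∅ := by
        unfold areaD
        exact Finset.sum_pos' (fun i _ => hd i) ⟨i1, by simp, hp⟩
      rw [zero_pow (by omega)]
      simp
    · rfl

lemma sq_term (V m n : ℕ) (hn : 1 ≤ n) (a : Fin (m + n) → ℤ) (l : Fin (m + n) → ℕ) :
    (∑ s ∈ range n, (-tK) ^ s • ∑ dr ∈ (Finset.univ : Finset (Fin (m + n))).powerset,
        if isPathEE a ∧ colIncr a l ∧
            (Finset.univ.filter (fun i => l i = 0)).card = m ∧
            (∀ i : Fin (m + n), l i = 0 → isValleyA a i) ∧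
            (∃ i : Fin (m + n), a i = minA a ∧ l i ≠ 0) ∧
            (∀ i : Fin (m + n), (i : ℕ) = 0 → a i = 0 → l i ≠ 0) ∧
            (∀ i ∈ dr, isRiseA a i) ∧ dr.card = s then
          (qK ^ dinvSqLab a l * tK ^ (areaSq a dr).toNat) • xmon V l
        else 0) = Zterm V m n a l := by
  have hN : 0 < m + n := by omega
  have := key_sum n (isPathEE a ∧ colIncr a l ∧
            (Finset.univ.filter (fun i => l i = 0)).card = m ∧
            (∀ i : Fin (m + n), l i = 0 → isValleyA a i) ∧
            (∃ i : Fin (m + n), a i = minA a ∧ l i ≠ 0) ∧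
            (∀ i : Fin (m + n), (i : ℕ) = 0 → a i = 0 → l i ≠ 0)) (isRiseA a) ?_
            (fun i => a i - minA a) ?_ tK
            (qK ^ dinvSqLab a l) (xmon V l)
  · simp only [and_assoc] at this
    unfold areaSq
    rw [this, Zterm]
    by_cases ha : a = 0
    · subst ha
      have hmin : minA (0 : Fin (m + n) → ℤ) = 0 := by
        rw [minA, dif_neg (by omega)]
        apply le_antisymm
        · exact Finset.inf'_le (0 : Fin (m + n) → ℤ) (Finset.mem_univ ⟨0, hN⟩)
        · exact Finset.le_inf' _ _ (fun i _ => le_rfl)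
      have hp : isPathEE (0 : Fin (m + n) → ℤ) :=
        ⟨fun _ _ => le_rfl, fun _ _ _ => by simp, fun _ _ => le_rfl⟩
      have hd : dinvSqLab (0 : Fin (m + n) → ℤ) l = dinvPairs 0 l := by
        simp [dinvSqLab, bonusLab]
      have e : ((∀ i : Fin (m + n), l i = 0 → isValleyA (0 : Fin (m + n) → ℤ) i) ∧
            (∃ i : Fin (m + n), (0 : Fin (m + n) → ℤ) i = 0 ∧ l i ≠ 0) ∧
            (∀ i : Fin (m + n), (i : ℕ) = 0 → (0 : Fin (m + n) → ℤ) i = 0 → l i ≠ 0)) ↔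
          (∀ i : Fin (m + n), (i : ℕ) = 0 → l i ≠ 0) := by
        constructor
        · rintro ⟨_, _, h⟩ i hi
          exact h i hi rfl
        · intro h
          refine ⟨fun i hi => Or.inr ?_, ⟨⟨0, hN⟩, rfl, h _ rfl⟩, fun i hi _ => h i hi⟩
          have hi0 : (i : ℕ) ≠ 0 := fun e => h i e hi
          refine ⟨⟨(i : ℕ) - 1, by omega⟩, ?_, le_rfl⟩
          simp only
          omega
      rw [hmin, hd]
      simp only [e, hp, colIncr_zero, true_and, not_rise_zero]
      simp
    · rw [if_neg (fun h : a = 0 ∧ _ => ha h.1)]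
      split_ifs with h
      · obtain ⟨⟨p1, p2, p3⟩, _, _, _, ⟨i0, hi0, _⟩, _⟩ := h
        have hrise : ∃ i, isRiseA a i ∧ a i = minA a + 1 := by
          have q1 := p1 ⟨0, hN⟩ rfl
          have q3 := p3 ⟨m + n - 1, by omega⟩ rfl
          have hle := minA_le a ⟨0, hN⟩
          by_cases hneg : minA a < 0
          · refine exists_rise a p2 (minA a) (minA_le a) i0 hi0 (m + n - 1 - i0)
              ⟨m + n - 1, by omega⟩ ?_ (by omega)
            have := i0.2
            simp only
            omega
          · obtain ⟨i1, hi1⟩ := Function.ne_iff.1 ha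
            have hle1 := minA_le a i1
            simp only [Pi.zero_apply] at hi1
            exact exists_rise a p2 (minA a) (minA_le a) ⟨0, hN⟩ (by omega) i1 i1 (by simp)
              (by omega)
        obtain ⟨i, hi, hi2⟩ := hrise
        rw [prod_zero_of_rise _ (fun i => a i - minA a) tK i hi (by omega), zero_smul]
      · rfl
  · rintro ⟨h1, h2, h3, h4, ⟨i0, hi0, hl0⟩, _⟩ dr hdr
    refine card_rises_lt (isRiseA a) l h3 (fun i => rise_label a l h2 i) i0 ?_ hl0 dr hdr
    rintro ⟨j, hj, hj2⟩
    have := minA_le a j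
    omega
  · rintro _ i
    have := minA_le a i
    omega

/-- For `m ≥ 0` and `n ≥ 1`,
`Σ_{s=0}^{n-1} (-t)^s PLSQ^E_{x,q,t}(m,n)^{*s} = PLD_{x,q,0}(m,n)^{*0}` and
`Σ_{s=0}^{n-1} (-t)^s PLD_{x,q,t}(m,n)^{*s} = PLD_{x,q,0}(m,n)^{*0}`
(evaluated at the variables `x_1, …, x_V`, for every `V`). -/
theorem delta_square_stmt14 (m n : ℕ) (hn : 1 ≤ n) (V : ℕ) :
    (∑ s ∈ range n, (-tK) ^ s • PLSQgf qK tK V m n s = PLDgf qK 0 V m n 0) ∧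
    (∑ s ∈ range n, (-tK) ^ s • PLDgf qK tK V m n s = PLDgf qK 0 V m n 0) := by
  constructor
  · unfold PLSQgf PLDgf
    simp only [Finset.smul_sum (N := MvPolynomial (Fin V) Kqt)]
    rw [Finset.sum_comm]
    refine Finset.sum_congr rfl fun a _ => ?_
    rw [Finset.sum_comm]
    refine Finset.sum_congr rfl fun l _ => ?_
    rw [pld0_term, ← sq_term V m n hn a l]
    simp only [Finset.smul_sum]
  · unfold PLDgf
    simp only [Finset.smul_sum (N := MvPolynomial (Fin V) Kqt)]
    rw [Finset.sum_comm]
    refine Finset.sum_congr rfl fun a _ => ?_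
    rw [Finset.sum_comm]
    refine Finset.sum_congr rfl fun l _ => ?_
    rw [pld0_term, ← pld_term V m n hn a l]
    simp only [Finset.smul_sum]


end
end

section
/- For j ≥ 1 and n > k ≥ 0, the skewing operator h_j^⊥ applied to PLD_{x,0,t}(0,n)^{*k} satisfies h_j^⊥ PLD_{x,0,t}(0,n)^{*k} = Σ_{r=0}^{j} t^{binom(j−r,2)} · qbinom(n−k, r)_t · qbinom(n−k−r, j−r)_t · PLD_{x,0,t}(0,n−j)^{*(k−j+r)}. -/
open scoped Classical
open MvPolynomial Finset

noncomputable section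

/-! ### Generalized Gaussian binomials -/
section GB
variable {K : Type*} [Field K] (t : K)

/-- Gaussian binomial with integer top. -/
def gbz (a : ℤ) (j : ℕ) : K := ∏ l ∈ range j, ((1 - t ^ (a - l)) / (1 - t ^ (l + 1)))

lemma gbz_zero (a : ℤ) : gbz t a 0 = 1 := by simp [gbz]

lemma gbz_succ (a : ℤ) (j : ℕ) :
    gbz t a (j + 1) = gbz t a j * ((1 - t ^ (a - j)) / (1 - t ^ (j + 1))) := by
  unfold gbz; rw [prod_range_succ]

variable {t}

lemma gbz_shift (m : ℤ) (j : ℕ) :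
    (1 - t ^ (m + 1)) * gbz t m j = (1 - t ^ (m + 1 - j)) * gbz t (m + 1) j := by
  induction j with
  | zero => simp [gbz_zero]
  | succ j ih =>
    rw [gbz_succ, gbz_succ, ← mul_assoc, ih]
    have : m + 1 - ((j + 1 : ℕ) : ℤ) = m - j := by push_cast; ring
    rw [this]
    ring

lemma gbz_up (m : ℤ) (j : ℕ) :
    gbz t (m + 1) (j + 1) = (1 - t ^ (m + 1)) * gbz t m j / (1 - t ^ (j + 1)) := by
  rw [gbz_succ, gbz_shift]; ring

lemma gbz_diff (ht : t ≠ 0) (ht1 : ∀ i : ℕ, t ^ (i + 1) ≠ 1) (m : ℤ) (j : ℕ) :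
    gbz t (m + 1) (j + 1) - gbz t m (j + 1) = t ^ (m - j) * gbz t m j := by
  have h := sub_ne_zero.mpr (ht1 j).symm
  rw [gbz_up, gbz_succ]
  have e : t ^ (m + 1) = t ^ (m - j) * t ^ (j + 1) := by
    rw [← zpow_natCast, ← zpow_add₀ ht]; congr 1; push_cast; ring
  rw [e]; field_simp; ring

lemma gbz_pascal (ht : t ≠ 0) (ht1 : ∀ i : ℕ, t ^ (i + 1) ≠ 1) (m : ℤ) (j : ℕ) :
    gbz t (m + 1) (j + 1) = t ^ (j + 1) * gbz t m (j + 1) + gbz t m j := by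
  have h := sub_ne_zero.mpr (ht1 j).symm
  rw [gbz_up, gbz_succ]
  have e : t ^ (m + 1) = t ^ (m - j) * t ^ (j + 1) := by
    rw [← zpow_natCast, ← zpow_add₀ ht]; congr 1; push_cast; ring
  rw [e]; field_simp; ring

lemma gbz_self (ht1 : ∀ i : ℕ, t ^ (i + 1) ≠ 1) (j : ℕ) : gbz t (j : ℤ) j = 1 := by
  induction j with
  | zero => exact gbz_zero t _
  | succ j ih =>
    have h := sub_ne_zero.mpr (ht1 j).symm
    push_cast
    rw [gbz_up, ih]
    have : t ^ ((j : ℤ) + 1) = t ^ (j + 1) := by exact_mod_cast zpow_natCast t (j + 1)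
    rw [this]; field_simp

lemma gbz_eq_zero (a j : ℕ) (h : a < j) : gbz t (a : ℤ) j = 0 := by
  unfold gbz
  apply prod_eq_zero (mem_range.mpr h)
  simp

/-! ### The operator `∏_{l<j} (1 + t^l σ)` -/

/-- The operator applied to a sequence. -/
def Pop (t : K) (d : ℤ → K) : ℕ → ℤ → K
  | 0, k => d k
  | j + 1, k => Pop t d j k + t ^ j * Pop t d j (k - 1)

lemma Pop_succ (d : ℤ → K) (j : ℕ) (k : ℤ) :
    Pop t d (j + 1) k = Pop t d j k + t ^ j * Pop t d j (k - 1) := rfl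

lemma Pop_asc (ht : t ≠ 0) (d d' : ℤ → K) (N : ℤ)
    (h : ∀ k, d' k = t ^ (N - k) * (d k + d (k - 1))) (j : ℕ) (k : ℤ) :
    Pop t d' j k = t ^ (N - k) * Pop t d (j + 1) k := by
  induction j generalizing k with
  | zero => simp [Pop, h]
  | succ j ih =>
    rw [Pop, ih, ih, Pop_succ d (j + 1)]
    have : N - (k - 1) = (N - k) + 1 := by ring
    rw [this, zpow_add_one₀ ht]; ring

lemma Pop_zero_of (d : ℤ → K) (B : ℤ) (h : ∀ k, B < k → d k = 0) (j : ℕ) (k : ℤ)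
    (hk : B + j < k) : Pop t d j k = 0 := by
  induction j generalizing k with
  | zero => exact h k (by simpa using hk)
  | succ j ih =>
    push_cast at hk
    rw [Pop, ih _ (by omega), ih _ (by omega)]; simp

lemma Pop_zero_neg (d : ℤ → K) (h : ∀ k, k < 0 → d k = 0) (j : ℕ) (k : ℤ)
    (hk : k < 0) : Pop t d j k = 0 := by
  induction j generalizing k with
  | zero => exact h k hk
  | succ j ih =>
    rw [Pop, ih _ (by omega), ih _ (by omega)]; simp

lemma Pop_at_zero (d : ℤ → K) (h : ∀ k, k < 0 → d k = 0) (j : ℕ) :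
    Pop t d j 0 = d 0 := by
  induction j with
  | zero => rfl
  | succ j ih => rw [Pop, ih, Pop_zero_neg d h _ _ (by omega)]; simp

/-- `q`-binomial theorem. -/
lemma Pop_expand (ht : t ≠ 0) (ht1 : ∀ i : ℕ, t ^ (i + 1) ≠ 1) (d : ℤ → K) (j : ℕ) (k : ℤ) :
    Pop t d j k = ∑ i ∈ range (j + 1), t ^ (i.choose 2) * gbz t (j : ℤ) i * d (k - i) := by
  induction j generalizing k with
  | zero => simp [Pop, gbz_zero]
  | succ j ih =>
    rw [Pop, ih, ih]
    rw [sum_range_succ' _ (j + 1)]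
    have hs : ∀ i ∈ range (j + 1),
        t ^ ((i + 1).choose 2) * gbz t ((j + 1 : ℕ) : ℤ) (i + 1) * d (k - ((i + 1 : ℕ) : ℤ)) =
        t ^ ((i + 1).choose 2) * gbz t (j : ℤ) (i + 1) * d (k - ((i + 1 : ℕ) : ℤ)) +
        t ^ j * (t ^ (i.choose 2) * gbz t (j : ℤ) i * d (k - 1 - i)) := by
      intro i hi
      have hij : i ≤ j := by simpa [Nat.lt_succ_iff] using hi
      have e1 := gbz_diff ht ht1 (j : ℤ) i
      have e2 : t ^ ((j : ℤ) - i) = t ^ (j - i) := by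
        rw [← zpow_natCast]; congr 1; omega
      rw [e2] at e1
      have e3 : (i + 1).choose 2 = i + i.choose 2 := by
        rw [Nat.choose_succ_succ' i 1]; simp
      have e4 : t ^ j = t ^ (j - i) * t ^ i := by rw [← pow_add]; congr 1; omega
      have e5 : k - ((i + 1 : ℕ) : ℤ) = k - 1 - i := by push_cast; ring
      rw [e5, e3, e4, pow_add]
      push_cast
      rw [sub_eq_iff_eq_add.mp e1]
      ring
    rw [sum_congr rfl hs, sum_add_distrib, mul_sum]
    have h2 : ∑ i ∈ range (j + 1), t ^ (i.choose 2) * gbz t (j : ℤ) i * d (k - i) =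
        ∑ i ∈ range (j + 1), t ^ ((i + 1).choose 2) * gbz t (j : ℤ) (i + 1) * d (k - ((i + 1 : ℕ) : ℤ))
          + d k := by
      rw [sum_range_succ', sum_range_succ _ j, gbz_eq_zero j (j + 1) (by omega)]
      simp [gbz_zero]
    rw [h2]
    simp [gbz_zero]
    ring

/-! ### Decorated weights of words -/

/-- Decorated weight of a word `w` preceded by `p`. -/
def Ewt (t : K) : ℕ → List ℕ → ℤ → K
  | _, [], k => if k = 0 then 1 else 0
  | p, x :: w, k =>
    if p < x then t ^ ((w.length : ℤ) + 1 - k) * (Ewt t x w k + Ewt t x w (k - 1))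
    else Ewt t x w k

lemma Ewt_neg (p : ℕ) (w : List ℕ) (k : ℤ) (hk : k < 0) : Ewt t p w k = 0 := by
  induction w generalizing p k with
  | nil => simp [Ewt, hk.ne]
  | cons x w ih => simp only [Ewt]; rw [ih x k hk, ih x (k - 1) (by omega)]; simp

lemma Ewt_replicate (M j : ℕ) (k : ℤ) :
    Ewt t M (List.replicate j M) k = if k = 0 then 1 else 0 := by
  induction j with
  | zero => rfl
  | succ j ih => simp [List.replicate_succ, Ewt, ih]

/-- Shuffles of `u` with `j` copies of `M`. -/
def Shf (M : ℕ) : ℕ → List ℕ → List (List ℕ)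
  | 0, u => [u]
  | j + 1, [] => (Shf M j []).map (M :: ·)
  | j + 1, x :: u => (Shf M (j + 1) u).map (x :: ·) ++ (Shf M j (x :: u)).map (M :: ·)

/-- Sum of decorated weights over shuffles. -/
def Rsum (t : K) (M j p : ℕ) (u : List ℕ) (k : ℤ) : K :=
  ((Shf M j u).map (fun w => Ewt t p w k)).sum

lemma Shf_length (M j : ℕ) (u w : List ℕ) (h : w ∈ Shf M j u) : w.length = u.length + j := by
  induction j generalizing u w with
  | zero => simp [Shf] at h; simp [h]
  | succ j ihj =>
    induction u generalizing w with
    | nil =>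
      simp only [Shf, List.mem_map] at h
      obtain ⟨v, hv, rfl⟩ := h
      have := ihj _ _ hv
      simp at this ⊢; omega
    | cons x u ihu =>
      simp only [Shf, List.mem_append, List.mem_map] at h
      rcases h with ⟨v, hv, rfl⟩ | ⟨v, hv, rfl⟩
      · have := ihu _ hv; simp at this ⊢; omega
      · have := ihj _ _ hv; simp at this ⊢; omega

lemma list_sum_add {α : Type*} (l : List α) (f g : α → K) :
    (l.map (fun x => f x + g x)).sum = (l.map f).sum + (l.map g).sum := by
  induction l with
  | nil => simp
  | cons a l ih => simp [ih]; ring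

lemma list_sum_mul {α : Type*} (l : List α) (c : K) (f : α → K) :
    (l.map (fun x => c * f x)).sum = c * (l.map f).sum := by
  induction l with
  | nil => simp
  | cons a l ih => simp [ih]; ring

/-- The contribution of words starting with `x`. -/
lemma map_cons_sum (M j p x : ℕ) (u : List ℕ) (k : ℤ) :
    (((Shf M j u).map (x :: ·)).map (fun w => Ewt t p w k)).sum =
      if p < x then t ^ ((u.length : ℤ) + j + 1 - k) * (Rsum t M j x u k + Rsum t M j x u (k - 1))
      else Rsum t M j x u k := by
  rw [List.map_map]
  split_ifs with h
  · unfold Rsum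
    rw [← list_sum_add, ← list_sum_mul]
    congr 1
    apply List.map_congr_left
    intro w hw
    have := Shf_length M j u w hw
    simp only [Function.comp, Ewt, if_pos h, this]
    push_cast; rfl
  · unfold Rsum
    congr 1
    apply List.map_congr_left
    intro w hw
    simp [Ewt, if_neg h]

lemma Rsum_zero (M p : ℕ) (u : List ℕ) (k : ℤ) : Rsum t M 0 p u k = Ewt t p u k := by
  simp [Rsum, Shf]

lemma Rsum_nil (M j p : ℕ) (k : ℤ) : Rsum t M (j + 1) p [] k =
    if p < M then t ^ ((j : ℤ) + 1 - k) * (Rsum t M j M [] k + Rsum t M j M [] (k - 1))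
      else Rsum t M j M [] k := by
  conv_lhs => rw [Rsum, Shf]
  rw [map_cons_sum]; simp

lemma Rsum_cons (M j p x : ℕ) (u : List ℕ) (k : ℤ) : Rsum t M (j + 1) p (x :: u) k =
    (if p < x then t ^ ((u.length : ℤ) + (j + 1) + 1 - k) *
        (Rsum t M (j + 1) x u k + Rsum t M (j + 1) x u (k - 1))
      else Rsum t M (j + 1) x u k) +
    (if p < M then t ^ ((u.length : ℤ) + 1 + j + 1 - k) *
        (Rsum t M j M (x :: u) k + Rsum t M j M (x :: u) (k - 1))
      else Rsum t M j M (x :: u) k) := by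
  conv_lhs => rw [Rsum, Shf, List.map_append, List.sum_append]
  rw [map_cons_sum, map_cons_sum]; simp

/-- `Q_{j,k}(x::u) = Q_{j-1,k}(x::u) + R_{j,k}(x,u)`. -/
lemma Q_cons (M j x : ℕ) (hx : x < M) (u : List ℕ) (k : ℤ) :
    Rsum t M (j + 1) M (x :: u) k = Rsum t M j M (x :: u) k + Rsum t M (j + 1) x u k := by
  rw [Rsum_cons]; simp [not_lt.mpr hx.le]; ring

lemma Q_nil (M j : ℕ) (k : ℤ) : Rsum t M j M [] k = if k = 0 then 1 else 0 := by
  induction j with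
  | zero => rw [Rsum_zero]; rfl
  | succ j ih => rw [Rsum_nil]; simp [ih]

/-- Does the word `p :: u` start with an ascent. -/
def startAsc (p : ℕ) : List ℕ → Prop
  | [] => False
  | y :: _ => p < y

lemma R_asc (M j p : ℕ) (hp : p < M) (u : List ℕ) (hu : ∀ x ∈ u, x < M) (k : ℤ)
    (h : startAsc p u) :
    Rsum t M (j + 1) p u k = t ^ ((u.length : ℤ) + j + 1 - k) *
      (Rsum t M (j + 1) M u k + Rsum t M (j + 1) M u (k - 1)) := by
  cases u with
  | nil => exact h.elim
  | cons y v =>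
    have hy : y < M := hu y (by simp)
    have h' : p < y := h
    rw [Rsum_cons, if_pos h', if_pos hp, Q_cons _ _ _ hy, Q_cons _ _ _ hy]
    have : (v.length : ℤ) + (j + 1) + 1 - k = (v.length : ℤ) + 1 + j + 1 - k := by ring
    rw [this]
    simp only [List.length_cons]; push_cast; ring

lemma R_nonasc (M j p : ℕ) (hp : p < M) (u : List ℕ) (hu : ∀ x ∈ u, x < M) (k : ℤ)
    (h : ¬ startAsc p u) :
    Rsum t M (j + 1) p u k = t ^ ((u.length : ℤ) + j + 1 - k) *
      (Rsum t M j M u k + Rsum t M j M u (k - 1)) + Rsum t M (j + 1) M u k - Rsum t M j M u k := by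
  cases u with
  | nil => rw [Rsum_nil, if_pos hp]; simp [Q_nil]
  | cons y v =>
    have hy : y < M := hu y (by simp)
    have h' : ¬ p < y := h
    rw [Rsum_cons, if_neg h', if_pos hp, Q_cons _ _ _ hy]
    simp only [List.length_cons]; push_cast; ring

lemma Ewt_asc (M p : ℕ) (hp : p < M) (u : List ℕ) (hu : ∀ x ∈ u, x < M) (k : ℤ)
    (h : startAsc p u) :
    Ewt t M (p :: u) k = t ^ ((u.length : ℤ) - k) * (Ewt t M u k + Ewt t M u (k - 1)) := by
  cases u with
  | nil => exact h.elim
  | cons y v =>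
    have hy : y < M := hu y (by simp)
    have h' : p < y := h
    simp [Ewt, not_lt.mpr hp.le, not_lt.mpr hy.le, h']

lemma Ewt_nonasc (M p : ℕ) (hp : p < M) (u : List ℕ) (hu : ∀ x ∈ u, x < M) (k : ℤ)
    (h : ¬ startAsc p u) :
    Ewt t M (p :: u) k = Ewt t M u k := by
  cases u with
  | nil => simp [Ewt, not_lt.mpr hp.le]
  | cons y v =>
    have hy : y < M := hu y (by simp)
    have h' : ¬ p < y := h
    simp [Ewt, not_lt.mpr hp.le, not_lt.mpr hy.le, h']

/-- The wordwise identity. -/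
theorem Q_formula (ht : t ≠ 0) (ht1 : ∀ i : ℕ, t ^ (i + 1) ≠ 1) (M j : ℕ) (u : List ℕ)
    (hu : ∀ x ∈ u, x < M) (k : ℤ) :
    Rsum t M j M u k = gbz t ((u.length : ℤ) + j - k) j * Pop t (Ewt t M u) j k := by
  induction u generalizing j k with
  | nil =>
    rw [Q_nil]
    split_ifs with h
    · subst h
      rw [Pop_at_zero _ (fun k hk => Ewt_neg M [] k hk)]
      simp [gbz_self ht1, Ewt]
    · rcases lt_or_gt_of_ne h with h | h
      · rw [Pop_zero_neg _ (fun k hk => Ewt_neg M [] k hk) _ _ h, mul_zero]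
      · by_cases hj : (j : ℤ) < k
        · rw [Pop_zero_of _ 0 (fun k hk => by simp [Ewt, hk.ne']) _ _ (by simpa using hj), mul_zero]
        · obtain ⟨a, ha⟩ : ∃ a : ℕ, ((([] : List ℕ).length : ℤ) + j - k) = a :=
            ⟨(j - k).toNat, by simp; omega⟩
          rw [ha, gbz_eq_zero a j (by simp at ha; omega), zero_mul]
  | cons p u ih =>
    have hp : p < M := hu p (by simp)
    have hu' : ∀ x ∈ u, x < M := fun x hx => hu x (by simp [hx])
    replace ih := ih
    have ih := fun j k => ih j hu' k
    induction j with
    | zero => simp [Rsum_zero, gbz_zero, Pop]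
    | succ j ihj =>
      rw [Q_cons _ _ _ hp, ihj]
      simp only [List.length_cons]
      obtain ⟨m, hm⟩ : ∃ m : ℤ, m = (u.length : ℤ) + j + 1 - k := ⟨_, rfl⟩
      have e1 : (((u.length + 1 : ℕ) : ℤ) + ((j + 1 : ℕ) : ℤ) - k) = m + 1 := by
        push_cast; omega
      have e2 : (((u.length + 1 : ℕ) : ℤ) + (j : ℤ) - k) = m := by push_cast; omega
      have e3 : (u.length : ℤ) + ((j + 1 : ℕ) : ℤ) - k = m := by push_cast; omega
      have e4 : (u.length : ℤ) + ((j + 1 : ℕ) : ℤ) - (k - 1) = m + 1 := by push_cast; omega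
      have e5 : (u.length : ℤ) + (j : ℤ) - (k - 1) = m := by omega
      have e6 : (u.length : ℤ) + (j : ℤ) - k = m - 1 := by omega
      by_cases h : startAsc p u
      · rw [R_asc M j p hp u hu' k h, ih, ih]
        have hd := fun j => Pop_asc ht (Ewt t M u) (Ewt t M (p :: u)) u.length
          (fun k => Ewt_asc M p hp u hu' k h) j k
        rw [hd, hd, e1, e2, e3, e4, ← hm, Pop_succ _ (j + 1), gbz_pascal ht ht1]
        have e7 : t ^ m = t ^ ((u.length : ℤ) - k) * t ^ (j + 1) := by
          rw [← zpow_natCast, ← zpow_add₀ ht]; congr 1; push_cast; omega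
        rw [e7]; ring
      · rw [R_nonasc M j p hp u hu' k h, ih, ih, ih]
        have hd : Ewt t M (p :: u) = Ewt t M u := funext fun k => Ewt_nonasc M p hp u hu' k h
        rw [hd, e1, e2, e3, e5, e6, ← hm, Pop_succ _ j]
        have g1 := gbz_diff ht ht1 m j
        have g2 := gbz_shift (t := t) (m - 1) j
        rw [sub_add_cancel] at g2
        have e7 : t ^ m = t ^ (m - j) * t ^ j := by
          rw [← zpow_natCast, ← zpow_add₀ ht]; congr 1; push_cast; omega
        rw [sub_eq_iff_eq_add.mp g1]
        have g3 : t ^ m * gbz t (m - 1) j = gbz t (m - 1) j - (1 - t ^ (m - j)) * gbz t m j := by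
          rw [← g2]; ring
        have : ∀ A B : K, t ^ m * (gbz t (m - 1) j * A + gbz t m j * B)
          = (t ^ m * gbz t (m - 1) j) * A + t ^ m * gbz t m j * B := by intros; ring
        rw [this, g3, e7]
        ring

end GB

/-! ### Sums over words -/

/-- Sum over words of length `n` in the letters `1..V`. -/
def WS {A : Type*} [AddCommMonoid A] (V : ℕ) : ℕ → (List ℕ → A) → A
  | 0, G => G []
  | n + 1, G => ∑ x ∈ range V, WS V n (fun w => G ((x + 1) :: w))

lemma WS_congr {A : Type*} [AddCommMonoid A] (V n : ℕ) (G H : List ℕ → A)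
    (h : ∀ w : List ℕ, w.length = n → (∀ x ∈ w, 1 ≤ x ∧ x ≤ V) → G w = H w) :
    WS V n G = WS V n H := by
  induction n generalizing G H with
  | zero => exact h [] rfl (by simp)
  | succ n ih =>
    simp only [WS]
    refine sum_congr rfl fun x hx => ih _ _ fun w hw hw' => h _ (by simp [hw]) ?_
    have hx' := mem_range.mp hx
    intro y hy
    rcases List.mem_cons.mp hy with rfl | hy
    · omega
    · exact hw' y hy

lemma WS_map {A B : Type*} [AddCommMonoid A] [AddCommMonoid B] (φ : A →+ B) (V n : ℕ)
    (G : List ℕ → A) : φ (WS V n G) = WS V n (fun w => φ (G w)) := by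
  induction n generalizing G with
  | zero => rfl
  | succ n ih => simp only [WS, map_sum, ih]

lemma WS_sum {A ι : Type*} [AddCommMonoid A] (s : Finset ι) (V n : ℕ)
    (G : ι → List ℕ → A) : WS V n (fun w => ∑ i ∈ s, G i w) = ∑ i ∈ s, WS V n (G i) := by
  induction n generalizing G with
  | zero => rfl
  | succ n ih => simp only [WS, ih]; rw [sum_comm]

lemma WS_add {A : Type*} [AddCommMonoid A] (V n : ℕ)
    (G H : List ℕ → A) : WS V n (fun w => G w + H w) = WS V n G + WS V n H := by
  induction n generalizing G H with
  | zero => rfl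
  | succ n ih => simp only [WS, ih, sum_add_distrib]

lemma WS_pi {A : Type*} [AddCommMonoid A] (V n : ℕ) (G : List ℕ → A) :
    ∑ l ∈ Fintype.piFinset (fun _ : Fin n => Finset.Icc 1 V), G (List.ofFn l) = WS V n G := by
  induction n generalizing G with
  | zero => simp [WS]
  | succ n ih =>
    simp only [WS, ← ih]
    rw [← sum_product']
    symm
    refine sum_bij' (fun xl _ => (Fin.cons (xl.1 + 1) xl.2 : Fin (n + 1) → ℕ))
      (fun l _ => (l 0 - 1, Fin.tail l)) ?_ ?_ ?_ ?_ ?_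
    · rintro ⟨x, l⟩ h
      simp only [mem_product, mem_range, Fintype.mem_piFinset, mem_Icc] at h ⊢
      intro i
      refine Fin.cases ?_ (fun i => ?_) i
      · simp; omega
      · simpa using h.2 i
    · intro l h
      simp only [mem_product, mem_range, Fintype.mem_piFinset, mem_Icc] at h ⊢
      refine ⟨by have := h 0; omega, fun i => h i.succ⟩
    · rintro ⟨x, l⟩ h; simp
    · intro l h
      simp only [Fintype.mem_piFinset, mem_Icc] at h
      have : l 0 - 1 + 1 = l 0 := by have := h 0; omega
      simp [this]
    · rintro ⟨x, l⟩ h; simp [List.ofFn_succ]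

/-- Sum over words with `j` letters `V+1` and `m` other letters. -/
def Tsh {A : Type*} [AddCommMonoid A] (V j m : ℕ) (G : List ℕ → A) : A :=
  WS V m (fun u => ((Shf (V + 1) j u).map G).sum)

lemma Tsh_zero_succ {A : Type*} [AddCommMonoid A] (V m : ℕ) (G : List ℕ → A) :
    Tsh V 0 (m + 1) G = ∑ x ∈ range V, Tsh V 0 m (fun w => G ((x + 1) :: w)) := by
  simp [Tsh, WS, Shf]

lemma Tsh_succ_zero {A : Type*} [AddCommMonoid A] (V j : ℕ) (G : List ℕ → A) :
    Tsh V (j + 1) 0 G = Tsh V j 0 (fun w => G ((V + 1) :: w)) := by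
  simp [Tsh, WS, Shf, Function.comp_def]

lemma Tsh_succ_succ {A : Type*} [AddCommMonoid A] (V j m : ℕ) (G : List ℕ → A) :
    Tsh V (j + 1) (m + 1) G = ∑ x ∈ range V, Tsh V (j + 1) m (fun w => G ((x + 1) :: w)) +
      Tsh V j (m + 1) (fun w => G ((V + 1) :: w)) := by
  simp [Tsh, WS, Shf, Function.comp_def, WS_add, sum_add_distrib]

lemma WS_split {A : Type*} [AddCommMonoid A] (V n : ℕ) (G : List ℕ → A) :
    WS (V + 1) n G = ∑ p ∈ antidiagonal n, Tsh V p.1 p.2 G := by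
  induction n generalizing G with
  | zero => simp [WS, Tsh, Shf]
  | succ n ih =>
    rw [WS, sum_range_succ]
    simp only [ih]
    rw [sum_comm]
    let A' : ℕ × ℕ → A := fun p => match p.2 with
      | 0 => 0
      | m + 1 => ∑ x ∈ range V, Tsh V p.1 m (fun w => G ((x + 1) :: w))
    let B' : ℕ × ℕ → A := fun p => match p.1 with
      | 0 => 0
      | j + 1 => Tsh V j p.2 (fun w => G ((V + 1) :: w))
    have h : ∀ p ∈ antidiagonal (n + 1), Tsh V p.1 p.2 G = A' p + B' p := by
      rintro ⟨j, m⟩ hp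
      rw [HasAntidiagonal.mem_antidiagonal] at hp
      rcases j with _ | j <;> rcases m with _ | m
      · simp at hp
      · simp [A', B', Tsh_zero_succ]
      · simp [A', B', Tsh_succ_zero]
      · simp [A', B', Tsh_succ_succ]
    rw [sum_congr rfl h, sum_add_distrib, Nat.sum_antidiagonal_succ' (f := A'),
      Nat.sum_antidiagonal_succ (f := B')]
    simp [A', B']

/-! ### Decorated sums -/

/-- Previous letter. -/
def prv {N : ℕ} (p : ℕ) (l : Fin N → ℕ) (i : Fin N) : ℕ :=
  (Fin.cons p l : Fin (N + 1) → ℕ) i.castSucc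

/-- Number of ascents up to `i`. -/
def ascA {N : ℕ} (p : ℕ) (l : Fin N → ℕ) (i : Fin N) : ℤ :=
  ∑ i' : Fin N, if i' ≤ i then (if prv p l i' < l i' then 1 else 0) else 0

lemma prv_cons_zero {N : ℕ} (p x : ℕ) (l : Fin N → ℕ) :
    prv p (Fin.cons x l : Fin (N + 1) → ℕ) 0 = p := by simp [prv]

lemma prv_cons_succ {N : ℕ} (p x : ℕ) (l : Fin N → ℕ) (i : Fin N) :
    prv p (Fin.cons x l : Fin (N + 1) → ℕ) i.succ = prv x l i := by
  simp [prv]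

lemma ascA_cons_zero {N : ℕ} (p x : ℕ) (l : Fin N → ℕ) :
    ascA p (Fin.cons x l : Fin (N + 1) → ℕ) 0 = if p < x then 1 else 0 := by
  simp [ascA, prv_cons_zero]

lemma ascA_cons_succ {N : ℕ} (p x : ℕ) (l : Fin N → ℕ) (i : Fin N) :
    ascA p (Fin.cons x l : Fin (N + 1) → ℕ) i.succ = (if p < x then 1 else 0) + ascA x l i := by
  simp [ascA, Fin.sum_univ_succ, prv_cons_zero, prv_cons_succ]

lemma sum_finset_succ {A : Type*} [AddCommMonoid A] {N : ℕ} (F : Finset (Fin (N + 1)) → A) :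
    ∑ dr, F dr = ∑ dr : Finset (Fin N), F (dr.map (Fin.succEmb N)) +
      ∑ dr : Finset (Fin N), F (insert 0 (dr.map (Fin.succEmb N))) := by
  have key : ∀ H : Finset (Fin (N + 1)) → A,
      ∑ dr ∈ ((univ : Finset (Fin N)).map (Fin.succEmb N)).powerset, H dr =
      ∑ dr : Finset (Fin N), H (dr.map (Fin.succEmb N)) := by
    intro H
    symm
    refine sum_nbij (fun dr => dr.map (Fin.succEmb N)) ?_ ?_ ?_ ?_
    · intro dr _; simp only [mem_powerset]; exact map_subset_map.mpr (subset_univ _)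
    · intro a _ b _ h; exact map_injective _ h
    · intro s hs
      simp only [coe_powerset, Set.mem_preimage, Set.mem_powerset_iff, coe_subset] at hs
      obtain ⟨u, _, rfl⟩ := subset_map_iff.mp hs
      exact ⟨u, by simp, rfl⟩
    · intros; rfl
  rw [← powerset_univ, Fin.univ_succ, cons_eq_insert, sum_powerset_insert (by simp), ← key F,
    ← key (fun s => F (insert 0 s))]
  rfl

/-- Sum over decorations. -/
lemma dec_sum {K : Type*} [Field K] {t : K} (ht : t ≠ 0) (N p : ℕ) (l : Fin N → ℕ) (k : ℤ) :
    ∑ dr : Finset (Fin N), (if (∀ i ∈ dr, prv p l i < l i) ∧ (dr.card : ℤ) = k then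
        t ^ (∑ i, if i ∈ dr then 0 else ascA p l i) else 0) = Ewt t p (List.ofFn l) k := by
  induction N generalizing p k with
  | zero => rw [Fintype.sum_subsingleton _ (∅ : Finset (Fin 0))]; simp [Ewt, eq_comm]
  | succ N ih =>
    obtain ⟨x, l, rfl⟩ : ∃ x l', l = (Fin.cons x l' : Fin (N + 1) → ℕ) :=
      ⟨l 0, Fin.tail l, by simp⟩
    rw [sum_finset_succ]
    have hF : List.ofFn (Fin.cons x l : Fin (N + 1) → ℕ) = x :: List.ofFn l := by
      simp [List.ofFn_succ]
    have hsum : ∀ dr : Finset (Fin N), (∑ i, if i ∈ dr then (0 : ℤ) else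
        ((if p < x then 1 else 0) + ascA x l i)) =
        (if p < x then 1 else 0) * ((N : ℤ) - dr.card) + ∑ i, if i ∈ dr then 0 else ascA x l i := by
      intro dr
      have : ∀ i, (if i ∈ dr then (0 : ℤ) else ((if p < x then 1 else 0) + ascA x l i)) =
          (if p < x then 1 else 0) * (1 - if i ∈ dr then 1 else 0) +
            (if i ∈ dr then 0 else ascA x l i) := by
        intro i; by_cases h : i ∈ dr <;> simp [h]
      rw [sum_congr rfl fun i _ => this i, sum_add_distrib, ← mul_sum, sum_sub_distrib]
      simp
    rw [hF, Ewt]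
    have h0 : ∀ dr : Finset (Fin N), (0 : Fin (N + 1)) ∉ dr.map (Fin.succEmb N) := by
      intro dr; simp
    simp only [Fin.sum_univ_succ, ascA_cons_zero, ascA_cons_succ, mem_insert, mem_map,
      Fin.coe_succEmb, Fin.succ_inj, exists_eq_right, Fin.succ_ne_zero, and_false, exists_false,
      if_false, true_or, if_true, false_or, card_map, card_insert_of_notMem (h0 _), zero_add,
      forall_eq_or_imp, prv_cons_zero, forall_exists_index, and_imp, forall_apply_eq_imp_iff₂,
      prv_cons_succ, Fin.cons_succ, Fin.cons_zero, hsum]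
    split_ifs with hpx
    · rw [mul_add, ← ih, ← ih, mul_sum, mul_sum]
      congr 1
      · refine sum_congr rfl fun dr _ => ?_
        rw [mul_ite, mul_zero]
        refine if_ctx_congr Iff.rfl (fun h => ?_) (fun _ => rfl)
        rw [← zpow_add₀ ht, h.2]; congr 1; simp; ring
      · refine sum_congr rfl fun dr _ => ?_
        rw [mul_ite, mul_zero]
        refine if_ctx_congr ?_ (fun h => ?_) (fun _ => rfl)
        · push_cast; simp only [hpx, true_and]
          refine and_congr Iff.rfl ?_; omega
        · rw [← zpow_add₀ ht, h.2]; congr 1; simp; ring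
    · rw [← ih]
      simp [hpx]

lemma prv_zero {N : ℕ} (p : ℕ) (l : Fin N → ℕ) (i : Fin N) (hi : (i : ℕ) = 0) :
    prv p l i = p := by
  have : i.castSucc = ⟨0, by omega⟩ := Fin.ext (by simpa using hi)
  unfold prv; rw [this]; rfl

lemma prv_succ {N : ℕ} (p : ℕ) (l : Fin N → ℕ) (i j : Fin N) (h : (j : ℕ) = i + 1) :
    prv p l j = l i := by
  have : j.castSucc = i.succ := Fin.ext (by simpa using h)
  unfold prv; rw [this]; simp

lemma ascA_zero {N : ℕ} (p : ℕ) (l : Fin N → ℕ) (hp : ∀ i, l i ≤ p) (i : Fin N)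
    (hi : (i : ℕ) = 0) : ascA p l i = 0 := by
  unfold ascA
  apply sum_eq_zero
  intro i' _
  split_ifs with h1 h2
  · have : (i' : ℕ) = 0 := by have := Fin.le_def.mp h1; omega
    rw [prv_zero p l i' this] at h2
    have := hp i'; omega
  · rfl
  · rfl

lemma ascA_succ {N : ℕ} (p : ℕ) (l : Fin N → ℕ) (i j : Fin N) (h : (j : ℕ) = i + 1) :
    ascA p l j = ascA p l i + if l i < l j then 1 else 0 := by
  have h1 : ∀ i' : Fin N, (if i' ≤ j then (if prv p l i' < l i' then (1 : ℤ) else 0) else 0) =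
      (if i' ≤ i then (if prv p l i' < l i' then 1 else 0) else 0) +
      if i' = j then (if prv p l i' < l i' then 1 else 0) else 0 := by
    intro i'
    have c1 : i' ≤ j ↔ (i' ≤ i ∨ i' = j) := by
      simp only [Fin.le_def, Fin.ext_iff]; omega
    by_cases c2 : i' = j
    · have c3 : ¬ i' ≤ i := by simp only [Fin.le_def]; subst c2; omega
      simp [c1, c2]
      intro h4; exact absurd h4 (by simpa [c2] using c3)
    · simp [c1, c2]
  unfold ascA
  rw [sum_congr rfl fun i' _ => h1 i', sum_add_distrib]
  simp [prv_succ p l i j h]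

lemma ascA_nonneg {N : ℕ} (p : ℕ) (l : Fin N → ℕ) (i : Fin N) : 0 ≤ ascA p l i := by
  unfold ascA
  apply sum_nonneg
  intro i _
  split_ifs <;> norm_num

lemma ascA_le {N : ℕ} (p : ℕ) (l : Fin N → ℕ) (i : Fin N) : ascA p l i ≤ N := by
  unfold ascA
  calc _ ≤ ∑ i' : Fin N, (1 : ℤ) := sum_le_sum fun i' _ => by split_ifs <;> norm_num
    _ = N := by simp

lemma ascA_unique {N : ℕ} (p : ℕ) (l : Fin N → ℕ) (hp : ∀ i, l i ≤ p) (a : Fin N → ℤ)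
    (h0 : ∀ i : Fin N, (i : ℕ) = 0 → a i = 0)
    (h1 : ∀ i j : Fin N, (j : ℕ) = (i : ℕ) + 1 → a j = a i + if l i < l j then 1 else 0) :
    a = ascA p l := by
  have : ∀ m : ℕ, ∀ i : Fin N, (i : ℕ) = m → a i = ascA p l i := by
    intro m
    induction m with
    | zero => intro i hi; rw [h0 i hi, ascA_zero p l hp i hi]
    | succ m ih =>
      intro i hi
      have hm : m < N := by have := i.2; omega
      rw [h1 ⟨m, hm⟩ i (by simpa using hi), ascA_succ p l ⟨m, hm⟩ i (by simpa using hi), ih _ rfl]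
  exact funext fun i => this _ i rfl

lemma dinvPairs_eq_zero {N : ℕ} (a : Fin N → ℤ) (l : Fin N → ℕ) :
    dinvPairs a l = 0 ↔ (∀ i j : Fin N, i < j → a i = a j → l j ≤ l i) ∧
      (∀ i j : Fin N, i < j → a i = a j + 1 → l i ≤ l j) := by
  unfold dinvPairs
  rw [Nat.add_eq_zero_iff, card_eq_zero, card_eq_zero, filter_eq_empty_iff, filter_eq_empty_iff]
  simp only [mem_univ, true_implies, Prod.forall, not_and, not_lt]

lemma good_iff {N : ℕ} (p : ℕ) (l : Fin N → ℕ) (hp : ∀ i, l i ≤ p) (a : Fin N → ℤ) :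
    (isDyckA a ∧ colIncr a l ∧ dinvPairs a l = 0) ↔ a = ascA p l := by
  rw [dinvPairs_eq_zero]
  constructor
  · rintro ⟨⟨d0, d1, d2⟩, hc, hA, hB⟩
    apply ascA_unique p l hp a d0
    intro i j hij
    have hlt : i < j := by simp only [Fin.lt_def]; omega
    rcases lt_trichotomy (a j) (a i) with h | h | h
    · exfalso
      -- last index `≤ i` with level `≤ a j`
      let S := univ.filter (fun i' : Fin N => i' ≤ i ∧ a i' ≤ a j)
      have hN : 0 < N := by have := i.2; omega
      have hS : S.Nonempty := ⟨⟨0, hN⟩, by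
        simp only [S, mem_filter, mem_univ, true_and]
        refine ⟨by simp [Fin.le_def], ?_⟩
        rw [d0 _ rfl]; exact d2 j⟩
      obtain ⟨i0, hi0, hmax⟩ := S.exists_max_image (fun i => (i : ℕ)) hS
      simp only [S, mem_filter, mem_univ, true_and] at hi0 hmax
      have hne : i0 ≠ i := by rintro rfl; omega
      have hlt0 : (i0 : ℕ) < i := by
        have := Fin.le_def.mp hi0.1
        have : (i0 : ℕ) ≠ i := fun e => hne (Fin.ext e)
        omega
      let i1 : Fin N := ⟨i0 + 1, by have := i.2; omega⟩
      have h1 : ¬ a i1 ≤ a j := by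
        intro h1
        have := hmax i1 ⟨by simp only [Fin.le_def, i1]; omega, h1⟩
        simp [i1] at this
      have h2 := d1 i0 i1 rfl
      have e1 : a i1 = a j + 1 := by omega
      have e0 : a i0 = a j := by omega
      have l1 := hc i0 i1 rfl (by omega)
      have l2 := hA i0 j (by simp only [Fin.lt_def]; omega) e0
      have l3 := hB i1 j (by simp only [Fin.lt_def, i1]; omega) e1
      omega
    · have := hA i j hlt h.symm
      rw [if_neg (by omega), h, add_zero]
    · have h1 := d1 i j hij
      have e : a j = a i + 1 := by omega
      rw [if_pos (hc i j hij e), e]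
  · rintro rfl
    have mono : ∀ m : ℕ, ∀ i j : Fin N, (j : ℕ) = i + m → ascA p l i ≤ ascA p l j ∧
        (ascA p l i = ascA p l j → l j ≤ l i) := by
      intro m
      induction m with
      | zero => intro i j h; have : i = j := Fin.ext (by omega)
                subst this; simp
      | succ m ih =>
        intro i j h
        let j' : Fin N := ⟨i + m, by have := j.2; omega⟩
        obtain ⟨h1, h2⟩ := ih i j' rfl
        have h3 := ascA_succ p l j' j (by simp [j']; omega)
        split_ifs at h3 with h4
        · exact ⟨by omega, fun e => by omega⟩
        · refine ⟨by omega, fun e => ?_⟩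
          have := h2 (by omega); omega
    refine ⟨⟨ascA_zero p l hp, ?_, ascA_nonneg p l⟩, ?_, ?_, ?_⟩
    · intro i j h; rw [ascA_succ p l i j h]; split_ifs <;> omega
    · intro i j h e; rw [ascA_succ p l i j h] at e
      by_contra h'; rw [if_neg h'] at e; omega
    · intro i j h e
      exact (mono (j - i) i j (by have := Fin.lt_def.mp h; omega)).2 e
    · intro i j h e
      have := (mono (j - i) i j (by have := Fin.lt_def.mp h; omega)).1
      omega

lemma isRise_asc {N : ℕ} (p : ℕ) (l : Fin N → ℕ) (hp : ∀ i, l i ≤ p) (i : Fin N) :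
    isRiseA (ascA p l) i ↔ prv p l i < l i := by
  constructor
  · rintro ⟨j, hj, e⟩
    rw [ascA_succ p l j i hj] at e
    rw [prv_succ p l j i hj]
    by_contra h'; rw [if_neg h'] at e; omega
  · intro h
    rcases Nat.eq_zero_or_pos (i : ℕ) with h0 | h0
    · rw [prv_zero p l i h0] at h; have := hp i; omega
    · have hj : (i : ℕ) = ((⟨i - 1, by omega⟩ : Fin N) : ℕ) + 1 := by simp; omega
      refine ⟨⟨i - 1, by omega⟩, hj, ?_⟩
      rw [ascA_succ p l _ i hj, if_pos]
      rwa [prv_succ p l _ i hj] at h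

/-- Monomial of a word. -/
def xmL (V : ℕ) (w : List ℕ) : MvPolynomial (Fin V) Kqt :=
  (w.map (fun x => if h : 0 < x ∧ x - 1 < V then (X (⟨x - 1, h.2⟩ : Fin V)) else 1)).prod

lemma xmon_eq (V : ℕ) {N : ℕ} (l : Fin N → ℕ) : xmon V l = xmL V (List.ofFn l) := by
  simp [xmon, xmL, List.map_ofFn, List.prod_ofFn]

lemma tK_ne : tK ≠ 0 := by
  unfold tK
  rw [Ne, FaithfulSMul.algebraMap_eq_zero_iff]
  exact X_ne_zero 1

lemma tK_pow_ne (i : ℕ) : tK ^ (i + 1) ≠ 1 := by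
  unfold tK
  intro h
  rw [← map_pow, ← map_one (algebraMap Rqt Kqt)] at h
  have h := FaithfulSMul.algebraMap_injective Rqt Kqt h
  have h2 := congrArg (MvPolynomial.eval (fun _ : Fin 2 => (0 : ℚ))) h
  simp at h2

lemma PLD_aux (V N p k : ℕ) (hp : V ≤ p) :
    (∑ a ∈ Fintype.piFinset (fun _ : Fin N => Finset.Icc (-(N : ℤ)) (N : ℤ)),
    ∑ l ∈ Fintype.piFinset (fun _ : Fin N => Finset.range (V + 1)),
      ∑ dr ∈ (Finset.univ : Finset (Fin N)).powerset,
        if isDyckA a ∧ colIncr a l ∧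
            (Finset.univ.filter (fun i => l i = 0)).card = 0 ∧
            (∀ i : Fin N, a i = (i : ℕ) → l i ≠ 0) ∧
            (∀ i ∈ dr, isRiseA a i) ∧ dr.card = k then
          ((0 : Kqt) ^ dinvPairs a l * tK ^ (areaD a dr).toNat) • xmon V l
        else 0) = WS V N (fun w => Ewt tK p w k • xmL V w) := by
  rw [sum_comm, ← WS_pi]
  have hsub : Fintype.piFinset (fun _ : Fin N => Finset.Icc 1 V) ⊆
      Fintype.piFinset (fun _ : Fin N => Finset.range (V + 1)) := by
    apply Fintype.piFinset_subset
    intro i x; simp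
  rw [← sum_subset hsub]
  · refine sum_congr rfl fun l hl => ?_
    simp only [Fintype.mem_piFinset, mem_Icc] at hl
    have hlp : ∀ i, l i ≤ p := fun i => (hl i).2.trans hp
    have hl0 : ∀ i, l i ≠ 0 := fun i => by have := (hl i).1; omega
    rw [sum_eq_single (ascA p l)]
    · rw [powerset_univ, ← dec_sum tK_ne, sum_smul]
      refine sum_congr rfl fun dr _ => ?_
      obtain ⟨g1, g2, g3⟩ := (good_iff p l hlp (ascA p l)).mpr rfl
      have hc : (Finset.univ.filter (fun i => l i = 0)).card = 0 := by simp [hl0]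
      rw [ite_smul, zero_smul]
      refine if_ctx_congr ?_ (fun h => ?_) (fun _ => rfl)
      · simp only [g1, g2, hc, isRise_asc p l hlp, true_and]
        constructor
        · rintro ⟨_, h1, h2⟩; exact ⟨h1, by exact_mod_cast h2⟩
        · rintro ⟨h1, h2⟩; exact ⟨fun i _ => hl0 i, h1, by exact_mod_cast h2⟩
      · rw [g3, pow_zero, one_mul, xmon_eq]
        congr 1
        have e : areaD (ascA p l) dr = ∑ i, if i ∈ dr then 0 else ascA p l i := by
          unfold areaD
          rw [sum_filter]
          refine sum_congr rfl fun i _ => ?_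
          by_cases h : i ∈ dr <;> simp [h]
        have e0 : 0 ≤ areaD (ascA p l) dr := by
          unfold areaD; exact sum_nonneg fun i _ => ascA_nonneg p l i
        rw [← e, ← zpow_natCast, Int.toNat_of_nonneg e0]
    · intro a _ hne
      apply sum_eq_zero
      intro dr _
      split_ifs with h
      · have : dinvPairs a l ≠ 0 := fun h0 =>
          hne ((good_iff p l hlp a).mp ⟨h.1, h.2.1, h0⟩)
        rw [zero_pow this, zero_mul, zero_smul]
      · rfl
    · intro h
      exfalso; apply h
      simp only [Fintype.mem_piFinset, mem_Icc]
      intro i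
      have := ascA_nonneg p l i
      have := ascA_le p l i
      omega
  · intro l hl hl'
    apply sum_eq_zero; intro a _
    apply sum_eq_zero; intro dr _
    rw [if_neg]
    rintro ⟨-, -, h, -⟩
    rw [card_eq_zero, filter_eq_empty_iff] at h
    apply hl'
    simp only [Fintype.mem_piFinset, mem_Icc, mem_range] at hl ⊢
    intro i
    have := hl i
    have := h (mem_univ i)
    omega

lemma PLD_WS (V n p k : ℕ) (hp : V ≤ p) :
    PLDgf 0 tK V 0 n k = WS V n (fun w => Ewt tK p w k • xmL V w) := by
  have := PLD_aux V (0 + n) p k hp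
  rw [show WS V n (fun w => Ewt tK p w k • xmL V w) =
    WS V (0 + n) (fun w => Ewt tK p w k • xmL V w) by rw [zero_add], ← this]
  rfl

/-! ### Extraction of the coefficient of the last variable -/

/-- Split off the last variable. -/
def phiV (V : ℕ) : MvPolynomial (Fin (V + 1)) Kqt →ₐ[Kqt] Polynomial (MvPolynomial (Fin V) Kqt) :=
  aeval (Fin.lastCases (motive := fun _ => Polynomial (MvPolynomial (Fin V) Kqt)) Polynomial.X
    (fun i => Polynomial.C (X i)))

lemma phiV_last (V : ℕ) : phiV V (X (Fin.last V)) = Polynomial.X := by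
  simp [phiV]

lemma phiV_castSucc (V : ℕ) (i : Fin V) : phiV V (X i.castSucc) = Polynomial.C (X i) := by
  simp [phiV]

lemma xmL_nil (V : ℕ) : xmL V [] = 1 := by simp [xmL]

lemma phiV_xmL_cons_M (V : ℕ) (w : List ℕ) :
    phiV V (xmL (V + 1) ((V + 1) :: w)) = Polynomial.X * phiV V (xmL (V + 1) w) := by
  have : xmL (V + 1) ((V + 1) :: w) = X (Fin.last V) * xmL (V + 1) w := by
    simp [xmL]; left; rfl
  rw [this, map_mul, phiV_last]

lemma phiV_xmL_cons (V : ℕ) (x : ℕ) (hx : 1 ≤ x ∧ x ≤ V) (w : List ℕ) :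
    ∃ y, phiV V (xmL (V + 1) (x :: w)) = Polynomial.C y * phiV V (xmL (V + 1) w) ∧
      ∀ u, xmL V (x :: u) = y * xmL V u := by
  refine ⟨X ⟨x - 1, by omega⟩, ?_, ?_⟩
  · have : xmL (V + 1) (x :: w) = X (Fin.castSucc ⟨x - 1, by omega⟩) * xmL (V + 1) w := by
      have h : 0 < x ∧ x - 1 < V + 1 := by omega
      simp only [xmL, List.map_cons, List.prod_cons]
      rw [dif_pos h]; rfl
    rw [this, map_mul, phiV_castSucc]
  · intro u
    have h : 0 < x ∧ x - 1 < V := by omega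
    simp only [xmL, List.map_cons, List.prod_cons]
    rw [dif_pos h]

lemma phiV_Shf (V i : ℕ) (u w : List ℕ) (hu : ∀ x ∈ u, 1 ≤ x ∧ x ≤ V)
    (hw : w ∈ Shf (V + 1) i u) :
    phiV V (xmL (V + 1) w) = Polynomial.X ^ i * Polynomial.C (xmL V u) := by
  induction i generalizing u w with
  | zero =>
    simp only [Shf, List.mem_singleton] at hw
    subst hw
    rw [pow_zero, one_mul]
    induction w with
    | nil => simp [xmL_nil]
    | cons x w ih =>
      obtain ⟨y, h1, h2⟩ := phiV_xmL_cons V x (hu x (by simp)) w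
      rw [h1, h2, ih (fun z hz => hu z (by simp [hz])), map_mul]
  | succ i ihi =>
    induction u generalizing w with
    | nil =>
      simp only [Shf, List.mem_map] at hw
      obtain ⟨w', hw', rfl⟩ := hw
      rw [phiV_xmL_cons_M, ihi [] w' hu hw']; ring
    | cons x u ihu =>
      simp only [Shf, List.mem_append, List.mem_map] at hw
      rcases hw with ⟨w', hw', rfl⟩ | ⟨w', hw', rfl⟩
      · obtain ⟨y, h1, h2⟩ := phiV_xmL_cons V x (hu x (by simp)) w'
        rw [h1, h2, ihu w' (fun z hz => hu z (by simp [hz])) hw', map_mul]; ring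
      · rw [phiV_xmL_cons_M, ihi _ w' hu hw']; ring

/-- Coefficient extraction as an additive map. -/
def coefHom (V j : ℕ) : MvPolynomial (Fin (V + 1)) Kqt →+ MvPolynomial (Fin V) Kqt :=
  ((Polynomial.lcoeff (MvPolynomial (Fin V) Kqt) j).toAddMonoidHom).comp
    (phiV V).toRingHom.toAddMonoidHom

lemma coefHom_apply (V j : ℕ) (P : MvPolynomial (Fin (V + 1)) Kqt) :
    coefHom V j P = (phiV V P).coeff j := rfl

lemma coef_Tsh (V j i m : ℕ) (k : ℤ) :
    coefHom V j (Tsh V i m (fun w => Ewt tK (V + 1) w k • xmL (V + 1) w)) =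
      if i = j then WS V m (fun u => Rsum tK (V + 1) i (V + 1) u k • xmL V u) else 0 := by
  rw [Tsh, WS_map]
  have : ∀ u : List ℕ, (∀ x ∈ u, 1 ≤ x ∧ x ≤ V) →
      coefHom V j (((Shf (V + 1) i u).map
        (fun w => Ewt tK (V + 1) w k • xmL (V + 1) w)).sum) =
      (if i = j then (1 : Kqt) else 0) • (Rsum tK (V + 1) i (V + 1) u k • xmL V u) := by
    intro u hu
    rw [Rsum]
    have key : ∀ w ∈ Shf (V + 1) i u, phiV V (xmL (V + 1) w) =
      Polynomial.X ^ i * Polynomial.C (xmL V u) := fun w hw => phiV_Shf V i u w hu hw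
    generalize Shf (V + 1) i u = S at key
    induction S with
    | nil => simp
    | cons a S ih =>
      simp only [List.map_cons, List.sum_cons, map_add]
      rw [ih (fun w hw => key w (by simp [hw])), add_smul, smul_add, coefHom_apply, map_smul,
        key a (by simp)]
      congr 1
      rw [Polynomial.coeff_smul, mul_comm, Polynomial.coeff_C_mul_X_pow]
      by_cases h : i = j
      · simp [h]
      · simp [h, Ne.symm h]
  rw [WS_congr V m _ _ (fun u _ hu => this u hu)]
  split_ifs with h
  · simp
  · simp only [zero_smul]
    exact (WS_map (0 : MvPolynomial (Fin V) Kqt →+ MvPolynomial (Fin V) Kqt) V m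
      (fun _ => 0)).symm

lemma coef_PLD (V j n k : ℕ) :
    (phiV V (PLDgf 0 tK (V + 1) 0 n k)).coeff j =
      if j ≤ n then WS V (n - j) (fun u => Rsum tK (V + 1) j (V + 1) u k • xmL V u) else 0 := by
  rw [← coefHom_apply, PLD_WS (V + 1) n (V + 1) k le_rfl, WS_split, map_sum]
  simp only [coef_Tsh]
  split_ifs with h
  · rw [sum_eq_single (j, n - j)]
    · simp
    · rintro ⟨a, b⟩ hab hne
      rw [HasAntidiagonal.mem_antidiagonal] at hab
      rw [if_neg]
      intro e; apply hne
      simp only at e hab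
      ext <;> simp <;> omega
    · intro hh
      exfalso; apply hh
      rw [HasAntidiagonal.mem_antidiagonal]; simp; omega
  · apply sum_eq_zero
    rintro ⟨a, b⟩ hab
    rw [HasAntidiagonal.mem_antidiagonal] at hab
    rw [if_neg]; simp only at hab ⊢; omega

/-! ### Gaussian binomials -/

lemma qfac_tK (n : ℕ) : qfacK tK n * (1 - tK) ^ n = ∏ i ∈ range n, (1 - tK ^ (i + 1)) := by
  unfold qfacK
  rw [← card_range n, ← prod_const, card_range, ← prod_mul_distrib]
  refine prod_congr rfl fun i _ => ?_
  unfold qaK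
  exact geom_sum_mul_neg tK (i + 1)

lemma fac_ne (n : ℕ) : ∏ i ∈ range n, (1 - tK ^ (i + 1)) ≠ 0 :=
  prod_ne_zero_iff.mpr fun i _ => sub_ne_zero.mpr (tK_pow_ne i).symm

lemma gbz_fac (b c : ℕ) : gbz tK ((b + c : ℕ) : ℤ) b * (∏ i ∈ range b, (1 - tK ^ (i + 1))) *
    (∏ i ∈ range c, (1 - tK ^ (i + 1))) = ∏ i ∈ range (b + c), (1 - tK ^ (i + 1)) := by
  induction b generalizing c with
  | zero => simp [gbz_zero]
  | succ b ih =>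
    have h1 := ih (c + 1)
    rw [prod_range_succ _ c, show b + (c + 1) = b + 1 + c by ring] at h1
    rw [← h1, gbz_succ, prod_range_succ _ b]
    have e : (tK : Kqt) ^ (((b + 1 + c : ℕ) : ℤ) - b) = tK ^ (c + 1) := by
      rw [← zpow_natCast]; congr 1; push_cast; ring
    rw [e]
    have := sub_ne_zero.mpr (tK_pow_ne b).symm
    field_simp

lemma qbin_gbz (b c : ℕ) : qbinK tK ((b + c : ℕ) : ℤ) (b : ℤ) = gbz tK ((b + c : ℕ) : ℤ) b := by
  rw [qbinK, if_pos (by constructor <;> push_cast <;> omega)]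
  have e1 : (((b + c : ℕ) : ℤ)).toNat = b + c := by omega
  have e2 : ((b : ℕ) : ℤ).toNat = b := by omega
  have e3 : (((b + c : ℕ) : ℤ) - b).toNat = c := by omega
  rw [e1, e2, e3]
  have h0 : (1 - tK : Kqt) ≠ 0 := by
    have := tK_pow_ne 0; simp at this; exact sub_ne_zero.mpr (Ne.symm this)
  have hf : ∀ n, qfacK tK n = (∏ i ∈ range n, (1 - tK ^ (i + 1))) / (1 - tK) ^ n := by
    intro n; rw [← qfac_tK]; field_simp
  rw [hf, hf, hf, ← gbz_fac b c]
  have h1 := fac_ne b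
  have h2 := fac_ne c
  field_simp
  ring

lemma qbin_zero (a b : ℤ) (h : a < b) : qbinK tK a b = 0 := by
  rw [qbinK, if_neg]; omega

lemma qbin_prod (N i r : ℕ) :
    qbinK tK (N : ℤ) (r : ℤ) * qbinK tK ((N : ℤ) - r) (i : ℤ) =
      gbz tK (N : ℤ) (i + r) * gbz tK ((i + r : ℕ) : ℤ) i := by
  by_cases h : i + r ≤ N
  · obtain ⟨c, rfl⟩ := Nat.exists_eq_add_of_le h
    have e1 : qbinK tK ((i + r + c : ℕ) : ℤ) (r : ℤ) = gbz tK ((r + (i + c) : ℕ) : ℤ) r := by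
      rw [← qbin_gbz]; congr 1; push_cast; ring
    have e2 : qbinK tK (((i + r + c : ℕ) : ℤ) - r) (i : ℤ) = gbz tK ((i + c : ℕ) : ℤ) i := by
      rw [← qbin_gbz]; congr 1; push_cast; ring
    rw [e1, e2]
    have f1 := gbz_fac r (i + c)
    have f2 := gbz_fac i c
    have f3 := gbz_fac (i + r) c
    have f4 := gbz_fac i r
    have h1 := fac_ne i
    have h2 := fac_ne c
    have h3 := fac_ne r
    rw [show r + (i + c) = i + r + c by ring] at f1 ⊢
    rw [← f2] at f1
    rw [← f4] at f3
    rw [← f3] at f1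
    have := mul_ne_zero (mul_ne_zero h1 h2) h3
    apply mul_right_cancel₀ this
    linear_combination f1
  · rw [gbz_eq_zero _ _ (by omega), zero_mul]
    rcases lt_or_ge N r with h' | h'
    · rw [qbin_zero (N : ℤ) r (by omega), zero_mul]
    · rw [qbin_zero ((N : ℤ) - r) i (by omega), mul_zero]

/-- The main identity in finitely many variables. -/
lemma main_fin (V j n k : ℕ) (hk : k < n) :
    (phiV V (PLDgf 0 tK (V + 1) 0 n k)).coeff j =
      ∑ r ∈ range (j + 1), (tK ^ Nat.choose (j - r) 2 * qbinK tK ((n : ℤ) - k) (r : ℤ) *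
          qbinK tK ((n : ℤ) - k - r) ((j : ℤ) - r)) •
        (if (k : ℤ) - j + r < 0 then 0 else PLDgf 0 tK V 0 (n - j) ((k : ℤ) - j + r).toNat) := by
  rw [coef_PLD]
  have hN : ((n : ℤ) - k) = ((n - k : ℕ) : ℤ) := by omega
  have hq : ∀ r ∈ range (j + 1), tK ^ Nat.choose (j - r) 2 * qbinK tK ((n : ℤ) - k) (r : ℤ) *
          qbinK tK ((n : ℤ) - k - r) ((j : ℤ) - r) =
      tK ^ Nat.choose (j - r) 2 * (gbz tK ((n : ℤ) - k) j * gbz tK (j : ℤ) (j - r)) := by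
    intro r hr
    rw [mem_range] at hr
    have := qbin_prod (n - k) (j - r) r
    rw [mul_assoc, hN, show ((j : ℤ) - r) = ((j - r : ℕ) : ℤ) by omega, this,
      show j - r + r = j by omega]
  rw [sum_congr rfl fun r hr => by rw [hq r hr]]
  split_ifs with h
  · rw [← sum_range_reflect]
    rw [WS_congr V (n - j) _ (fun u => ∑ i ∈ range (j + 1),
      (tK ^ Nat.choose i 2 * (gbz tK ((n : ℤ) - k) j * gbz tK (j : ℤ) i)) •
        (Ewt tK (V + 1) u ((k : ℤ) - i) • xmL V u))]
    · rw [WS_sum]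
      refine sum_congr rfl fun i hi => ?_
      rw [mem_range] at hi
      rw [show j + 1 - 1 - i = j - i by omega, show j - (j - i) = i by omega,
        show (k : ℤ) - j + ((j - i : ℕ) : ℤ) = k - i by omega]
      have hs := WS_map (DistribSMul.toAddMonoidHom (MvPolynomial (Fin V) Kqt)
        (tK ^ Nat.choose i 2 * (gbz tK ((n : ℤ) - k) j * gbz tK (j : ℤ) i))) V (n - j)
        (fun u => Ewt tK (V + 1) u ((k : ℤ) - i) • xmL V u)
      simp only [DistribSMul.toAddMonoidHom_apply] at hs
      rw [← hs]
      congr 1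
      split_ifs with hneg
      · rw [WS_congr V (n - j) _ (fun _ => 0)]
        · exact (WS_map (0 : MvPolynomial (Fin V) Kqt →+ MvPolynomial (Fin V) Kqt) V (n - j)
            (fun _ => 0)).symm
        · intro u _ _
          rw [Ewt_neg _ _ _ hneg, zero_smul]
      · rw [PLD_WS V (n - j) (V + 1) _ (by omega), Int.toNat_of_nonneg (by omega)]
    · intro u hu hu'
      rw [Q_formula tK_ne tK_pow_ne (V + 1) j u (fun x hx => by have := hu' x hx; omega) k,
        Pop_expand tK_ne tK_pow_ne, hu, mul_sum, sum_smul]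
      refine sum_congr rfl fun i _ => ?_
      rw [smul_smul, show (((n - j : ℕ) : ℤ) + j - k) = n - k by omega]
      congr 1; ring
  · symm
    apply sum_eq_zero
    intro r _
    rw [hN, gbz_eq_zero _ _ (by omega)]; simp

/-! ### The symmetric function side -/

lemma hallH_eq_sum (f g : SymF) (S : Finset (ℕ+ →₀ ℕ)) (h : f.support ⊆ S) :
    hallH f g = ∑ d ∈ S, coeff d f * coeff d g * zzH d := by
  unfold hallH
  apply sum_subset h
  intro d _ hd
  rw [MvPolynomial.notMem_support_iff] at hd
  simp [hd]

lemma hallH_add_left (f f' g : SymF) : hallH (f + f') g = hallH f g + hallH f' g := by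
  rw [hallH_eq_sum (f + f') g (f.support ∪ f'.support) MvPolynomial.support_add,
    hallH_eq_sum f g _ subset_union_left, hallH_eq_sum f' g _ subset_union_right,
    ← sum_add_distrib]
  refine sum_congr rfl fun d _ => ?_
  rw [coeff_add]; ring

lemma hallH_add_right (f g g' : SymF) : hallH f (g + g') = hallH f g + hallH f g' := by
  unfold hallH
  rw [← sum_add_distrib]
  refine sum_congr rfl fun d _ => ?_
  rw [coeff_add]; ring

lemma hallH_smul_right (f g : SymF) (c : Kqt) : hallH f (c • g) = c * hallH f g := by
  unfold hallH
  rw [mul_sum]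
  refine sum_congr rfl fun d _ => ?_
  rw [coeff_smul, smul_eq_mul]; ring

lemma hallH_monomial (d : ℕ+ →₀ ℕ) (a : Kqt) (g : SymF) :
    hallH (monomial d a) g = a * coeff d g * zzH d := by
  rw [hallH_eq_sum _ g {d} MvPolynomial.support_monomial_subset]
  simp

lemma hallH_zero_right (f : SymF) : hallH f 0 = 0 := by simp [hallH]

lemma hallH_monomial_right (f : SymF) (d : ℕ+ →₀ ℕ) :
    hallH f (monomial d 1) = coeff d f * zzH d := by
  unfold hallH
  by_cases h : d ∈ f.support
  · rw [sum_eq_single_of_mem d h]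
    · simp
    · intro b _ hb
      rw [coeff_monomial, if_neg hb.symm]; simp
  · rw [sum_eq_zero]
    · rw [MvPolynomial.notMem_support_iff] at h; simp [h]
    · intro b hb
      rw [coeff_monomial, if_neg (by rintro rfl; exact h hb)]; simp

lemma zzH_ne (d : ℕ+ →₀ ℕ) : zzH d ≠ 0 := by
  unfold zzH
  refine prod_ne_zero_iff.mpr fun i _ => mul_ne_zero (pow_ne_zero _ ?_) ?_
  · exact_mod_cast i.pos.ne'
  · exact_mod_cast Nat.factorial_ne_zero _

lemma zzH_eq (d : ℕ+ →₀ ℕ) (S : Finset ℕ+) (h : d.support ⊆ S) :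
    zzH d = ∏ i ∈ S, (((i : ℕ+) : ℕ) : Kqt) ^ d i * ((Nat.factorial (d i) : ℕ) : Kqt) := by
  unfold zzH
  apply prod_subset h
  intro i _ hi
  rw [Finsupp.notMem_support_iff] at hi
  simp [hi]

lemma zzH_add (d : ℕ+ →₀ ℕ) (k : ℕ+) :
    zzH (d + Finsupp.single k 1) = (((k : ℕ+) : ℕ) : Kqt) * ((d k : Kqt) + 1) * zzH d := by
  rw [zzH_eq (d + Finsupp.single k 1) (insert k d.support), zzH_eq d (insert k d.support)]
  · rw [← mul_prod_erase _ _ (mem_insert_self k d.support),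
      ← mul_prod_erase (insert k d.support)
        (fun i => (((i : ℕ+) : ℕ) : Kqt) ^ d i * ((Nat.factorial (d i) : ℕ) : Kqt))
        (mem_insert_self k d.support), ← mul_assoc]
    congr 1
    · simp [Nat.factorial_succ, pow_succ]; ring
    · refine prod_congr rfl fun i hi => ?_
      have : i ≠ k := ne_of_mem_erase hi
      simp [Finsupp.single_apply, this.symm]
  · exact subset_insert _ _
  · intro i hi
    rw [Finsupp.mem_support_iff] at hi
    by_cases h : i = k
    · simp [h]
    · simp [Finsupp.single_apply, Ne.symm h] at hi
      simp [hi]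

lemma hallH_X_mul (k : ℕ+) (g y : SymF) :
    hallH (X k * g) y = (((k : ℕ+) : ℕ) : Kqt) * hallH g (pderiv k y) := by
  induction g using MvPolynomial.induction_on' with
  | monomial d a =>
    rw [X, monomial_mul, one_mul, hallH_monomial, hallH_monomial, add_comm (Finsupp.single k 1),
      zzH_add, coeff_pderiv]
    ring
  | add p q hp hq => rw [mul_add, hallH_add_left, hallH_add_left, hp, hq, mul_add]

/-- The weight of an exponent vector. -/
def wtE (d : ℕ+ →₀ ℕ) : ℕ := d.sum fun i m => m * (i : ℕ)

lemma wtE_add (d : ℕ+ →₀ ℕ) (k : ℕ+) : wtE (d + Finsupp.single k 1) = wtE d + k := by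
  unfold wtE
  rw [Finsupp.sum_add_index' (by simp) (by intros; ring), Finsupp.sum_single_index (by simp),
    one_mul]

lemma part_exp {n : ℕ} (μ : n.Partition) :
    ∃ d : ℕ+ →₀ ℕ, μ.parts = (Finsupp.toMultiset d).map (fun i : ℕ+ => (i : ℕ)) := by
  have h : ∀ s : Multiset ℕ, (∀ a ∈ s, 0 < a) →
      ∃ d : ℕ+ →₀ ℕ, s = (Finsupp.toMultiset d).map (fun i : ℕ+ => (i : ℕ)) := by
    intro s
    induction s using Multiset.induction with
    | empty => intro _; exact ⟨0, by simp⟩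
    | cons a s ih =>
      intro hs
      obtain ⟨d, hd⟩ := ih (fun b hb => hs b (by simp [hb]))
      obtain ⟨b, hb⟩ : ∃ b : ℕ+, (b : ℕ) = a := ⟨⟨a, hs a (by simp)⟩, rfl⟩
      refine ⟨Finsupp.single b 1 + d, ?_⟩
      have e := Finsupp.toMultiset_single b 1
      rw [map_add, Multiset.map_add, e, one_smul, Multiset.map_singleton, ← hd, hb]
      rfl
  exact h _ fun a ha => μ.parts_pos ha

/-- The exponent vector of a partition. -/
def Epart {n : ℕ} (μ : n.Partition) : ℕ+ →₀ ℕ := (part_exp μ).choose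

lemma Epart_spec {n : ℕ} (μ : n.Partition) :
    μ.parts = (Finsupp.toMultiset (Epart μ)).map (fun i : ℕ+ => (i : ℕ)) := (part_exp μ).choose_spec

lemma wt_toMultiset (d : ℕ+ →₀ ℕ) :
    ((Finsupp.toMultiset d).map (fun i : ℕ+ => (i : ℕ))).sum = wtE d := by
  induction d using Finsupp.induction_linear with
  | zero => simp [wtE]
  | add f g hf hg =>
    rw [map_add, Multiset.map_add, Multiset.sum_add, hf, hg]
    unfold wtE
    rw [Finsupp.sum_add_index' (by simp) (by intros; ring)]
  | single a b => rw [Finsupp.toMultiset_single, Multiset.map_nsmul, Multiset.sum_nsmul]; simp [wtE]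

lemma pProd_eq {n : ℕ} (μ : n.Partition) : pProdP μ = monomial (Epart μ) 1 := by
  have h1 : pProdP μ = (μ.parts.map ppSym).prod := by
    unfold pProdP partsListP
    rw [List.map_reverse, List.prod_reverse]
    conv_rhs => rw [← Multiset.sort_eq μ.parts (· ≤ ·), Multiset.map_coe, Multiset.prod_coe]
  rw [h1, Epart_spec, Multiset.map_map]
  have h2 : (ppSym ∘ fun i : ℕ+ => (i : ℕ)) = fun i => (X i : SymF) := by
    funext i
    simp [ppSym, i.pos]
    rfl
  rw [h2]
  generalize Epart μ = d
  induction d using Finsupp.induction_linear with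
  | zero => simp
  | add f g hf hg => rw [map_add, Multiset.map_add, Multiset.prod_add, hf, hg, monomial_mul, one_mul]
  | single a b =>
    rw [Finsupp.toMultiset_single, Multiset.map_nsmul, Multiset.prod_nsmul]
    simp [X_pow_eq_monomial]

lemma zmu_eq {n : ℕ} (μ : n.Partition) : zmuP μ = zzH (Epart μ) := by
  unfold zmuP zzH
  rw [Epart_spec, prod_mul_distrib]
  generalize Epart μ = d
  congr 1
  · simp only [Multiset.bind_def, Multiset.pure_def, Multiset.bind_singleton, Multiset.map_map]
    change _ = d.prod (fun i m => (((i : ℕ+) : ℕ) : Kqt) ^ m)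
    induction d using Finsupp.induction_linear with
    | zero => simp
    | add f g hf hg =>
      rw [map_add, Multiset.map_add, Multiset.prod_add, hf, hg,
        Finsupp.prod_add_index' (by simp) (by intros; ring)]
    | single a b =>
      rw [Finsupp.toMultiset_single, Multiset.map_nsmul, Multiset.prod_nsmul]
      simp
  · have : ((Finsupp.toMultiset d).map (fun i : ℕ+ => (i : ℕ))).toFinset =
      d.support.image (fun i : ℕ+ => (i : ℕ)) := by
      rw [Multiset.toFinset_map, Finsupp.toFinset_toMultiset]
    rw [this, prod_image (fun a _ b _ h => PNat.coe_injective h)]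
    refine prod_congr rfl fun i _ => ?_
    rw [Multiset.count_map_eq_count' _ _ PNat.coe_injective, Finsupp.count_toMultiset]

lemma coeff_hSym (j : ℕ) (e : ℕ+ →₀ ℕ) :
    coeff e (hSym j) = if wtE e = j then (zzH e)⁻¹ else 0 := by
  unfold hSym
  rw [coeff_sum]
  simp only [coeff_smul, pProd_eq, zmu_eq, coeff_monomial, smul_eq_mul]
  split_ifs with h
  · let μ : j.Partition := ⟨(Finsupp.toMultiset e).map (fun i : ℕ+ => (i : ℕ)), by
      intro i hi
      obtain ⟨a, _, rfl⟩ := Multiset.mem_map.mp hi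
      exact a.pos, by rw [wt_toMultiset, h]⟩
    have hμ : Epart μ = e := by
      have := Epart_spec μ
      exact (Multiset.toFinsupp.symm.injective (Multiset.map_injective PNat.coe_injective this)).symm
    rw [sum_eq_single μ]
    · simp [hμ]
    · intro ν _ hν
      rw [if_neg, mul_zero]
      intro h'
      apply hν
      apply Nat.Partition.ext
      rw [Epart_spec ν, Epart_spec μ, hμ, h']
    · simp
  · apply sum_eq_zero
    intro ν _
    rw [if_neg, mul_zero]
    intro h'
    apply h
    rw [← h', ← wt_toMultiset, ← Epart_spec, ν.parts_sum]

lemma pderiv_hSym (k : ℕ+) (j : ℕ) :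
    (((k : ℕ+) : ℕ) : Kqt) • pderiv k (hSym j) = if (k : ℕ) ≤ j then hSym (j - k) else 0 := by
  ext e
  rw [coeff_smul, coeff_pderiv, coeff_hSym, wtE_add, zzH_add, smul_eq_mul]
  have h1 : (((k : ℕ+) : ℕ) : Kqt) ≠ 0 := by exact_mod_cast k.pos.ne'
  have h2 : ((e k : Kqt) + 1) ≠ 0 := by exact_mod_cast Nat.succ_ne_zero (e k)
  have h3 := zzH_ne e
  split_ifs with h h' h'
  · rw [coeff_hSym, if_pos (by omega)]; field_simp
  · omega
  · rw [coeff_hSym, if_neg (by omega)]; simp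
  · simp

/-- The map `f[X] ↦ f[X + y]`. -/
def tauS : SymF →ₐ[Kqt] Polynomial SymF :=
  aeval (fun k : ℕ+ => Polynomial.C (X k : SymF) + Polynomial.X ^ (k : ℕ))

lemma zzH_zero : zzH 0 = 1 := by simp [zzH]

lemma hall_skew (f : SymF) : ∀ (j : ℕ) (y : SymF),
    hallH f (hSym j * y) = hallH ((tauS f).coeff j) y := by
  induction f using MvPolynomial.induction_on with
  | C a =>
    intro j y
    have : tauS (C a) = Polynomial.C (C a) := by
      simp [tauS]
    rw [this, Polynomial.coeff_C]
    have e : hallH (C a) (hSym j * y) = a * coeff 0 (hSym j * y) * zzH 0 := hallH_monomial 0 a _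
    rw [e]
    have e2 : coeff 0 (hSym j * y) = coeff 0 (hSym j) * coeff 0 y := by
      simp only [← constantCoeff_eq, map_mul]
    rw [e2, coeff_hSym]
    have w0 : wtE 0 = 0 := by simp [wtE]
    rw [w0, zzH_zero]
    split_ifs with h1 h2 h2
    · have e' : hallH (C a) y = a * coeff 0 y * zzH 0 := hallH_monomial 0 a _
      rw [e', zzH_zero]; simp
    · omega
    · omega
    · simp [hallH]
  | add p q hp hq =>
    intro j y
    rw [hallH_add_left, hp, hq, map_add, Polynomial.coeff_add, hallH_add_left]
  | mul_X p k hp =>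
    intro j y
    have e1 : tauS (p * X k) = Polynomial.C (X k) * tauS p + tauS p * Polynomial.X ^ (k : ℕ) := by
      rw [map_mul]
      have : tauS (X k) = Polynomial.C (X k : SymF) + Polynomial.X ^ (k : ℕ) := by simp [tauS]
      rw [this]; ring
    rw [e1, Polynomial.coeff_add, Polynomial.coeff_C_mul, Polynomial.coeff_mul_X_pow',
      hallH_add_left, mul_comm p, hallH_X_mul, hallH_X_mul, ← hp, Derivation.leibniz,
      hallH_add_right, mul_add, smul_eq_mul, smul_eq_mul]
    congr 1
    rw [← hallH_smul_right, mul_comm y, ← smul_mul_assoc, pderiv_hSym]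
    split_ifs with h
    · rw [hp]
    · simp [hallH]

lemma skew_eq (f F : SymF) (j : ℕ) (hF : ∀ y : SymF, hallH F y = hallH f (hSym j * y)) :
    F = (tauS f).coeff j := by
  ext c
  have h := hF (monomial c 1)
  rw [hall_skew, hallH_monomial_right, hallH_monomial_right] at h
  exact mul_right_cancel₀ (zzH_ne c) h

lemma pKV_tau (V : ℕ) (f : SymF) (j : ℕ) :
    pKV V ((tauS f).coeff j) = (phiV V (pKV (V + 1) f)).coeff j := by
  have h : (Polynomial.mapAlgHom (pKV V)).comp tauS = (phiV V).comp (pKV (V + 1)) := by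
    apply MvPolynomial.algHom_ext
    intro k
    simp only [AlgHom.comp_apply, tauS, pKV, aeval_X, map_add, map_sum, map_pow,
      Fin.sum_univ_castSucc, phiV_last, phiV_castSucc]
    simp
  have := congrArg (fun P => Polynomial.coeff P j) (DFunLike.congr_fun h f)
  simpa using this

/-! ### Algebraic independence of power sums -/

/-- Substitution of power sums. -/
def psiV (V : ℕ) : MvPolynomial (Fin V) Kqt →ₐ[Kqt] MvPolynomial (Fin V) Kqt :=
  aeval (fun k : Fin V => ∑ i : Fin V, (X i : MvPolynomial (Fin V) Kqt) ^ ((k : ℕ) + 1))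

lemma psiV_X (V : ℕ) (k : Fin V) :
    psiV V (X k) = ∑ i : Fin V, (X i : MvPolynomial (Fin V) Kqt) ^ ((k : ℕ) + 1) := by
  simp [psiV]

lemma psiV_C (V : ℕ) (a : Kqt) : psiV V (C a) = C a := by
  rw [psiV, aeval_C]; rfl

lemma pderiv_psum (V : ℕ) (i k : Fin V) :
    pderiv i (psiV V (X k)) = C (((k : ℕ) : Kqt) + 1) * X i ^ (k : ℕ) := by
  rw [psiV_X, map_sum, sum_eq_single i]
  · rw [pderiv_pow, pderiv_X_self]; simp
  · intro b _ hb
    rw [pderiv_pow, pderiv_X_of_ne hb]; simp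
  · simp

lemma psiV_chain (V : ℕ) (i : Fin V) (F : MvPolynomial (Fin V) Kqt) :
    pderiv i (psiV V F) =
      ∑ k : Fin V, (psiV V (pderiv k F) * C (((k : ℕ) : Kqt) + 1)) * X i ^ (k : ℕ) := by
  induction F using MvPolynomial.induction_on with
  | C a => simp [psiV_C]
  | add p q hp hq => simp only [map_add, hp, hq, add_mul, sum_add_distrib]
  | mul_X p n hp =>
    rw [map_mul, Derivation.leibniz, hp, pderiv_psum, smul_eq_mul, smul_eq_mul]
    simp only [Derivation.leibniz, map_add, smul_eq_mul, map_mul, add_mul, sum_add_distrib]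
    congr 1
    · rw [sum_eq_single n]
      · rw [pderiv_X_self]; simp; ring
      · intro b _ hb
        rw [pderiv_X_of_ne hb.symm]; simp
      · simp
    · rw [mul_sum]
      refine sum_congr rfl fun k _ => by ring

lemma const_of_pderiv (V : ℕ) (F : MvPolynomial (Fin V) Kqt) (h : ∀ k, pderiv k F = 0) :
    F = C (coeff 0 F) := by
  ext d
  rw [coeff_C]
  split_ifs with hd
  · rw [hd]
  · have : ∃ k, d k ≠ 0 := by
      by_contra hc
      push Not at hc
      apply hd; ext k; simp [hc k]
    obtain ⟨k, hk⟩ := this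
    have e : d = (d - Finsupp.single k 1) + Finsupp.single k 1 := by
      ext m
      by_cases hm : k = m
      · subst hm; simp; omega
      · simp [Finsupp.single_apply, hm]
    have := congrArg (coeff (d - Finsupp.single k 1)) (h k)
    rw [coeff_pderiv, ← e, coeff_zero] at this
    rcases mul_eq_zero.mp this with h1 | h1
    · exact h1
    · exfalso
      have : ((((d - Finsupp.single k 1 : Fin V →₀ ℕ) k) + 1 : ℕ) : Kqt) = 0 := by push_cast; exact h1
      exact Nat.succ_ne_zero _ (Nat.cast_eq_zero.mp this)

lemma psiV_inj_aux (V N : ℕ) : ∀ F : MvPolynomial (Fin V) Kqt,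
    (∀ d, coeff d F ≠ 0 → d.degree < N) → psiV V F = 0 → F = 0 := by
  induction N with
  | zero =>
    intro F h _
    ext d
    by_contra hc
    exact absurd (h d hc) (by omega)
  | succ N ih =>
    intro F h h0
    have hd : ∀ k, pderiv k F = 0 := by
      intro k
      apply ih
      · intro d hc
        rw [coeff_pderiv] at hc
        have := h _ (left_ne_zero_of_mul hc)
        rw [map_add, Finsupp.degree_single] at this
        omega
      · have hv := Matrix.eq_zero_of_forall_index_sum_mul_pow_eq_zero
          (f := fun i : Fin V => (X i : MvPolynomial (Fin V) Kqt))
          (v := fun k => psiV V (pderiv k F) * C (((k : ℕ) : Kqt) + 1))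
          (X_injective) (fun i => by rw [← psiV_chain, h0, map_zero])
        have hv' := congrFun hv k
        simp only [Pi.zero_apply] at hv'
        rcases mul_eq_zero.mp hv' with h1 | h1
        · exact h1
        · exfalso
          rw [C_eq_zero] at h1
          exact Nat.succ_ne_zero (k : ℕ) (by exact_mod_cast h1)
    have e := const_of_pderiv V F hd
    rw [e, psiV_C] at h0
    rw [e, h0]

lemma psiV_inj (V : ℕ) (F : MvPolynomial (Fin V) Kqt) (h : psiV V F = 0) : F = 0 := by
  refine psiV_inj_aux V (F.totalDegree + 1) F (fun d hd => ?_) h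
  have := MvPolynomial.le_totalDegree (mem_support_iff.mpr hd)
  have e : d.degree = d.sum fun _ e => e := rfl
  omega

lemma pKV_inj (F G : SymF) (h : ∀ V, pKV V F = pKV V G) : F = G := by
  rw [← sub_eq_zero]
  have h : ∀ V, pKV V (F - G) = 0 := fun V => by rw [map_sub, h V, sub_self]
  generalize F - G = P at h
  obtain ⟨V, hV⟩ : ∃ V : ℕ, ∀ k ∈ P.vars, (k : ℕ) ≤ V :=
    ⟨P.vars.sup (fun k => (k : ℕ)), fun k hk => le_sup (f := fun k : ℕ+ => (k : ℕ)) hk⟩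
  have hinj : Function.Injective (fun i : Fin V => Nat.succPNat (i : ℕ)) := by
    intro a b hab
    exact Fin.ext (Nat.succPNat_injective hab)
  obtain ⟨Q, rfl⟩ := exists_rename_eq_of_vars_subset_range P
    (fun i : Fin V => Nat.succPNat (i : ℕ)) hinj (by
      intro k hk
      have h1 := hV k hk
      have h2 := k.pos
      refine ⟨⟨(k : ℕ) - 1, by omega⟩, ?_⟩
      apply PNat.coe_injective
      simp
      omega)
  have hQ : psiV V Q = 0 := by
    rw [← h V, pKV, aeval_rename]
    rfl
  rw [psiV_inj V Q hQ, map_zero]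

/-- For `j ≥ 1` and `n > k ≥ 0`, the skewing operator `h_j^⊥`
(the Hall-adjoint of multiplication by `h_j`) applied to the symmetric function
`PLD_{x,0,t}(0,n)^{*k}` satisfies
`h_j^⊥ PLD_{x,0,t}(0,n)^{*k}
  = Σ_{r=0}^{j} t^(binom(j-r,2)) qbinom(n-k,r)_t qbinom(n-k-r,j-r)_t
      PLD_{x,0,t}(0,n-j)^{*(k-j+r)}`,
with the convention `PLD_{x,0,t}(0,n-j)^{*s} = 0` for `s < 0`. Here `f` is the
symmetric function representing `PLD_{x,0,t}(0,n)^{*k}`, `g s` represents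
`PLD_{x,0,t}(0,n-j)^{*s}`, and `F = h_j^⊥ f` is characterized by adjointness. -/
theorem delta_square_stmt16 (n k j : ℕ) (hj : 1 ≤ j) (hk : k < n)
    (f : SymF) (hf : ∀ V, pKV V f = PLDgf 0 tK V 0 n k)
    (g : ℤ → SymF) (hg : ∀ s : ℕ, ∀ V, pKV V (g s) = PLDgf 0 tK V 0 (n - j) s)
    (hgneg : ∀ z : ℤ, z < 0 → g z = 0)
    (F : SymF) (hF : ∀ y : SymF, hallH F y = hallH f (hSym j * y)) :
    F = ∑ r ∈ range (j + 1),
        (tK ^ Nat.choose (j - r) 2 * qbinK tK ((n : ℤ) - k) (r : ℤ) *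
          qbinK tK ((n : ℤ) - k - r) ((j : ℤ) - r)) • g ((k : ℤ) - j + r) := by
  apply pKV_inj
  intro V
  rw [skew_eq f F j hF, pKV_tau, hf, main_fin V j n k hk, map_sum]
  refine sum_congr rfl fun r _ => ?_
  rw [map_smul]
  congr 1
  split_ifs with h
  · rw [hgneg _ h, map_zero]
  · rw [← hg, Int.toNat_of_nonneg (by omega)]

end
end
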